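/- Let P be a convex polyhedron inscribed in the unit sphere S² in ℝ³ with m faces, all of which are triangles, and set k = m/2 + 2 (which equals the number of vertices of P). Then η(P) ≥ 2·sin(36°)·√(1 − d_k²/4) ≥ sin(36°)/sin(30°·(m+4)/m) (angles: 36° = π/5, 30° = π/6). -/

import Mathlib

open scoped Real
open Filter

noncomputable section

abbrev E3 := EuclideanSpace ℝ (Fin 3)

/-- `F` is a face of dimension `d` of the convex body `P`:
a nonempty convex extreme subset whose affine hull has dimension `d`. -/
def IsFaceDim (P F : Set E3) (d : ℕ) : Prop :=
  F.Nonempty ∧ Convex ℝ F ∧ IsExtreme ℝ P F ∧ Module.finrank ℝ (vectorSpan ℝ F) = d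

/-- A convex polyhedron inscribed in the unit sphere `S²` in `ℝ³`, given as the convex hull
of a finite vertex set `V ⊆ S²` each point of which is an extreme point of the hull,
which is three-dimensional, all of whose 2-dimensional faces are triangles,
and which has exactly `m` faces (2-dimensional faces). -/
structure InscribedTriPoly (m : ℕ) where
  V : Finset E3
  on_sphere : ∀ v ∈ V, ‖v‖ = 1
  is_vertex : ∀ v ∈ V, v ∈ Set.extremePoints ℝ (convexHull ℝ (V : Set E3))
  full_dim : affineSpan ℝ (V : Set E3) = ⊤
  faces_triangles : ∀ F : Set E3, IsFaceDim (convexHull ℝ (V : Set E3)) F 2 →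
      ∃ a b c : E3, a ∈ V ∧ b ∈ V ∧ c ∈ V ∧ AffineIndependent ℝ ![a, b, c] ∧
        F = convexHull ℝ ({a, b, c} : Set E3)
  card_faces : {F : Set E3 | IsFaceDim (convexHull ℝ (V : Set E3)) F 2}.ncard = m

/-- The set of lengths of the edges (1-dimensional faces) of the polytope `conv V`. -/
def edgeLengths (V : Finset E3) : Set ℝ :=
  {d : ℝ | ∃ p q : E3, p ≠ q ∧ IsFaceDim (convexHull ℝ (V : Set E3)) (segment ℝ p q) 1 ∧
    d = dist p q}

/-- `η` : quotient of the longest edge length by the shortest edge length. -/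
def eta (V : Finset E3) : ℝ := sSup (edgeLengths V) / sInf (edgeLengths V)

/-- `e m` : the infimum of `η P` over all convex polyhedra `P` inscribed in the unit
sphere with exactly `m` faces, all triangles. -/
def e (m : ℕ) : ℝ := sInf {x : ℝ | ∃ P : InscribedTriPoly m, x = eta P.V}

/-- `d k` : the maximum (supremum) over all systems of `k` points on the unit sphere `S²`
of the minimal pairwise Euclidean distance. -/
def dSphere (k : ℕ) : ℝ :=
  sSup {x : ℝ | ∃ P : Fin k → E3, (∀ i, ‖P i‖ = 1) ∧
    x = sInf {d : ℝ | ∃ i j : Fin k, i ≠ j ∧ d = dist (P i) (P j)}}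

/-- `1 - cos ρ`, expressed through `y = cot ρ`. -/
def capProfile (y : ℝ) : ℝ := 1 - y / √(1 + y ^ 2)

lemma capProfile_antitone : Antitone capProfile := by
  intro x y hxy
  unfold capProfile
  have hx : 0 < √(1 + x ^ 2) := by positivity
  have hy : 0 < √(1 + y ^ 2) := by positivity
  have h1 : x / √(1 + x ^ 2) ≤ y / √(1 + y ^ 2) := by
    rw [div_le_div_iff₀ hx hy]
    rcases le_total 0 x with h0 | h0
    · have h0y : 0 ≤ y := h0.trans hxy
      rw [← Real.sqrt_sq h0, ← Real.sqrt_sq h0y, ← Real.sqrt_mul (by positivity),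
        ← Real.sqrt_mul (by positivity), Real.sqrt_sq h0, Real.sqrt_sq h0y]
      apply Real.sqrt_le_sqrt
      nlinarith
    · rcases le_total 0 y with h0y | h0y
      · exact (mul_nonpos_of_nonpos_of_nonneg h0 hy.le).trans (by positivity)
      · have h2 : (-y) * √(1 + x ^ 2) ≤ (-x) * √(1 + y ^ 2) := by
          rw [← Real.sqrt_sq (neg_nonneg.2 h0), ← Real.sqrt_sq (neg_nonneg.2 h0y),
            ← Real.sqrt_mul (by positivity), ← Real.sqrt_mul (by positivity)]
          simp only [neg_sq]
          apply Real.sqrt_le_sqrt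
          nlinarith
        linarith
  linarith

lemma continuous_capProfile : Continuous capProfile := by
  unfold capProfile
  refine continuous_const.sub (continuous_id.div (by fun_prop) fun x => ?_)
  positivity

lemma capProfile_nonneg (y : ℝ) : 0 ≤ capProfile y := by
  unfold capProfile
  have h : 0 < √(1 + y ^ 2) := by positivity
  rw [sub_nonneg, div_le_one h]
  exact (le_abs_self y).trans (Real.abs_le_sqrt (by linarith))

lemma mul_cos_le_mul_cos {s κ β β' u : ℝ} (hβ0 : 0 < β) (hβ : β ≤ π / 2) (hβ' : 0 ≤ β')
    (hββ : β' ≤ β) (hs : κ ≤ s) (hκ : 0 < κ)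
    (heq : κ * Real.cos β' = s * Real.cos β) (hu0 : 0 ≤ u) (hu : u ≤ β) :
    κ * Real.cos (β' / β * u) ≤ s * Real.cos u := by
  have hπ := Real.pi_pos
  set τ := β' / β with hτ
  have hτβ : τ * β = β' := by rw [hτ]; field_simp
  have hτ0 : 0 ≤ τ := by positivity
  have hτ1 : τ ≤ 1 := by rw [hτ]; exact (div_le_one hβ0).2 hββ
  have hcu : 0 ≤ Real.cos u :=
    Real.cos_nonneg_of_neg_pi_div_two_le_of_le (by linarith) (by linarith)
  rcases hβ.lt_or_eq with hlt | rfl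
  · have hcβ : 0 < Real.cos β := Real.cos_pos_of_mem_Ioo ⟨by linarith, hlt⟩
    have key : Real.cos (τ * u) * Real.cos β ≤ Real.cos u * Real.cos β' := by
      have e1 : Real.cos (β + τ * u) ≤ Real.cos (u + β') := by
        apply Real.cos_le_cos_of_nonneg_of_le_pi (by positivity)
        · nlinarith
        · nlinarith
      have e2 : Real.cos (β - τ * u) ≤ Real.cos (u - β') := by
        rw [← Real.cos_abs (u - β')]
        apply Real.cos_le_cos_of_nonneg_of_le_pi (by positivity)
        · nlinarith
        · rw [abs_le]; constructor <;> nlinarith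
      rw [Real.cos_add, Real.cos_add] at e1
      rw [Real.cos_sub, Real.cos_sub] at e2
      linarith
    have h2 : κ * Real.cos (τ * u) * Real.cos β ≤ s * Real.cos u * Real.cos β := by
      calc κ * Real.cos (τ * u) * Real.cos β = κ * (Real.cos (τ * u) * Real.cos β) := by ring
        _ ≤ κ * (Real.cos u * Real.cos β') := by gcongr
        _ = Real.cos u * (κ * Real.cos β') := by ring
        _ = s * Real.cos u * Real.cos β := by rw [heq]; ring
    exact le_of_mul_le_mul_right h2 hcβ
  · rw [Real.cos_pi_div_two, mul_zero] at heq
    have hc : Real.cos β' = 0 := by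
      rcases mul_eq_zero.1 heq with h | h
      · linarith
      · exact h
    have : β' = π / 2 := by
      by_contra hne
      have : 0 < Real.cos β' := Real.cos_pos_of_mem_Ioo ⟨by linarith, lt_of_le_of_ne hββ hne⟩
      linarith
    have h1 : τ = 1 := by rw [hτ, this]; field_simp
    rw [h1, one_mul]
    gcongr

lemma mean_capProfile_le {s κ β β' : ℝ} (hβ0 : 0 < β) (hβ : β ≤ π / 2) (hβ' : 0 < β')
    (hββ : β' ≤ β) (hs : κ ≤ s) (hκ : 0 < κ)
    (heq : κ * Real.cos β' = s * Real.cos β) :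
    β' * ((∫ u in (0 : ℝ)..β, capProfile (s * Real.cos u)) / β) ≤
      ∫ t in (0 : ℝ)..β', capProfile (κ * Real.cos t) := by
  have hc := continuous_capProfile
  have hτ : β' / β ≠ 0 := by positivity
  have h1 := intervalIntegral.integral_comp_mul_left (a := 0) (b := β)
    (fun t => capProfile (κ * Real.cos t)) hτ
  rw [mul_zero, div_mul_cancel₀ _ hβ0.ne'] at h1
  have h2 : ∫ u in (0 : ℝ)..β, capProfile (s * Real.cos u) ≤
      ∫ u in (0 : ℝ)..β, capProfile (κ * Real.cos (β' / β * u)) := by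
    apply intervalIntegral.integral_mono_on hβ0.le
    · exact (hc.comp (by fun_prop)).intervalIntegrable _ _
    · exact (hc.comp (by fun_prop)).intervalIntegrable _ _
    · intro u hu
      exact capProfile_antitone (mul_cos_le_mul_cos hβ0 hβ hβ'.le hββ hs hκ heq hu.1 hu.2)
  rw [h1, smul_eq_mul] at h2
  calc β' * ((∫ u in (0 : ℝ)..β, capProfile (s * Real.cos u)) / β)
      = (β' / β) * ∫ u in (0 : ℝ)..β, capProfile (s * Real.cos u) := by ring
    _ ≤ (β' / β) * ((β' / β)⁻¹ * ∫ t in (0 : ℝ)..β', capProfile (κ * Real.cos t)) := by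
        gcongr
    _ = _ := by field_simp

lemma integral_capProfile {K β s : ℝ} (hK0 : 0 < K) (hK1 : K < 1) (hs : s = K / √(1 - K ^ 2)) :
    ∫ u in (0 : ℝ)..β, capProfile (s * Real.cos u) = β - Real.arcsin (K * Real.sin β) := by
  have hK2 : 0 < 1 - K ^ 2 := by nlinarith
  have hd : ∀ u : ℝ, HasDerivAt (fun u => u - Real.arcsin (K * Real.sin u))
      (capProfile (s * Real.cos u)) u := by
    intro u
    have hlt : |K * Real.sin u| < 1 := by
      rw [abs_mul, abs_of_pos hK0]
      nlinarith [Real.abs_sin_le_one u, abs_nonneg (Real.sin u)]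
    rw [abs_lt] at hlt
    have h1 : HasDerivAt (fun u => K * Real.sin u) (K * Real.cos u) u :=
      (Real.hasDerivAt_sin u).const_mul K
    have h2 := (Real.hasDerivAt_arcsin (by linarith : K * Real.sin u ≠ -1)
      (by linarith : K * Real.sin u ≠ 1)).comp u h1
    convert! (hasDerivAt_id u).sub h2 using 1
    unfold capProfile
    have hp : 0 < 1 - (K * Real.sin u) ^ 2 := by nlinarith
    have e : 1 + (s * Real.cos u) ^ 2 = (1 - (K * Real.sin u) ^ 2) / (1 - K ^ 2) := by
      rw [hs, mul_pow, div_pow, Real.sq_sqrt hK2.le]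
      have := Real.sin_sq_add_cos_sq u
      field_simp
      nlinarith
    rw [e, Real.sqrt_div hp.le, hs]
    have q1 : 0 < √(1 - K ^ 2) := Real.sqrt_pos.2 hK2
    have q2 : 0 < √(1 - (K * Real.sin u) ^ 2) := Real.sqrt_pos.2 hp
    field_simp
  rw [intervalIntegral.integral_eq_sub_of_hasDerivAt (fun u _ => hd u)]
  · simp
  · exact (continuous_capProfile.comp (by fun_prop)).intervalIntegrable _ _

/-- The defect of the profile from its model mean `M` along the arc where `κ cos > c`. -/
def arcDefect (M c κ ψ φ : ℝ) : ℝ :=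
  if c < κ * Real.cos (φ - ψ) then M - capProfile (κ * Real.cos (φ - ψ)) else 0

lemma integral_arcDefect_nonpos {s κ β ψ : ℝ} (hβ0 : 0 < β) (hβ : β ≤ π / 2) (hκ0 : 0 ≤ κ)
    (hs : κ ≤ s) :
    ∫ φ in (-π)..π, arcDefect ((∫ u in (0 : ℝ)..β, capProfile (s * Real.cos u)) / β)
      (s * Real.cos β) κ ψ φ ≤ 0 := by
  have hπ := Real.pi_pos
  have hle := fun β' => mean_capProfile_le (s := s) (κ := κ) (β' := β') hβ0 hβ
  set M := (∫ u in (0 : ℝ)..β, capProfile (s * Real.cos u)) / β with hM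
  set c := s * Real.cos β with hc
  have hcβ : 0 ≤ Real.cos β :=
    Real.cos_nonneg_of_neg_pi_div_two_le_of_le (by linarith) (by linarith)
  have hc0 : 0 ≤ c := mul_nonneg (hκ0.trans hs) hcβ
  have hper : Function.Periodic (arcDefect M c κ 0) (2 * π) := by
    intro x
    unfold arcDefect
    rw [sub_zero, sub_zero, Real.cos_add_two_pi]
  have hshift : ∫ φ in (-π)..π, arcDefect M c κ ψ φ = ∫ φ in (-π)..π, arcDefect M c κ 0 φ := by
    have e : ∀ φ, arcDefect M c κ ψ φ = arcDefect M c κ 0 (φ - ψ) := fun φ => by simp [arcDefect]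
    simp_rw [e]
    rw [intervalIntegral.integral_comp_sub_right]
    have := hper.intervalIntegral_add_eq (-π - ψ) (-π)
    convert this using 2 <;> ring
  rw [hshift]
  by_cases hκc : κ ≤ c
  · have hz : ∀ φ, arcDefect M c κ 0 φ = 0 := by
      intro φ
      unfold arcDefect
      rw [if_neg]
      have := Real.cos_le_one (φ - 0)
      nlinarith
    simp [hz]
  push Not at hκc
  have hκ : 0 < κ := hc0.trans_lt hκc
  set β' := Real.arccos (c / κ) with hβ'
  have hcos : κ * Real.cos β' = c := by
    rw [hβ', Real.cos_arccos]
    · field_simp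
    · linarith [div_nonneg hc0 hκ.le]
    · exact (div_le_one hκ).2 hκc.le
  have hβ'0 : 0 < β' := Real.arccos_pos.2 ((div_lt_one hκ).2 hκc)
  have hββ : β' ≤ β := by
    have h1 : Real.cos β ≤ c / κ := by
      rw [le_div_iff₀ hκ, hc]
      nlinarith
    have h2 := Real.arccos_le_arccos h1
    rwa [Real.arccos_cos hβ0.le (by linarith)] at h2
  have hfun : ∀ φ ∈ Set.Icc (-π) π, arcDefect M c κ 0 φ =
      (Set.Ioc (-β') β').indicator (fun φ => M - capProfile (κ * Real.cos φ)) φ ∨ φ = β' := by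
    intro φ hφ
    by_cases hφβ : φ = β'
    · exact Or.inr hφβ
    left
    have hiff : c < κ * Real.cos φ ↔ |φ| < β' := by
      rw [← hcos, mul_lt_mul_iff_right₀ hκ, ← Real.cos_abs φ]
      exact Real.strictAntiOn_cos.lt_iff_gt ⟨hβ'0.le, by linarith⟩
        ⟨abs_nonneg _, abs_le.2 hφ⟩
    unfold arcDefect Set.indicator
    rw [sub_zero]
    by_cases h : |φ| < β'
    · rw [if_pos (hiff.2 h), if_pos]
      rw [abs_lt] at h
      exact ⟨h.1, h.2.le⟩
    · rw [if_neg (fun h' => h (hiff.1 h')), if_neg]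
      rintro ⟨h1, h2⟩
      exact h (abs_lt.2 ⟨h1, lt_of_le_of_ne h2 hφβ⟩)
  have hInt : ∫ φ in (-π)..π, arcDefect M c κ 0 φ =
      ∫ φ in (-β')..β', (M - capProfile (κ * Real.cos φ)) := by
    rw [intervalIntegral.integral_of_le (by linarith),
      intervalIntegral.integral_of_le (by linarith),
      ← MeasureTheory.integral_indicator measurableSet_Ioc,
      ← MeasureTheory.integral_indicator measurableSet_Ioc]
    apply MeasureTheory.integral_congr_ae
    have hne : ∀ᵐ φ : ℝ, φ ≠ β' := by simp [MeasureTheory.ae_iff]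
    filter_upwards [hne] with φ hφ
    by_cases h : φ ∈ Set.Ioc (-π) π
    · rw [Set.indicator_of_mem h]
      exact (hfun φ ⟨h.1.le, h.2⟩).resolve_right hφ
    · rw [Set.indicator_of_notMem h, Set.indicator_of_notMem]
      exact fun h' => h ⟨by linarith [h'.1], by linarith [h'.2]⟩
  have hcont : Continuous fun φ => M - capProfile (κ * Real.cos φ) :=
    continuous_const.sub (continuous_capProfile.comp (by fun_prop))
  have heven : ∫ φ in (-β')..0, (M - capProfile (κ * Real.cos φ)) =
      ∫ φ in (0 : ℝ)..β', (M - capProfile (κ * Real.cos φ)) := by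
    have := intervalIntegral.integral_comp_neg (a := 0) (b := β')
      (fun φ => M - capProfile (κ * Real.cos φ))
    simp only [Real.cos_neg, neg_zero] at this
    exact this.symm
  rw [hInt, ← intervalIntegral.integral_add_adjacent_intervals (hcont.intervalIntegrable _ 0)
    (hcont.intervalIntegrable 0 _), heven]
  have h0 : ∫ φ in (0 : ℝ)..β', (M - capProfile (κ * Real.cos φ)) ≤ 0 := by
    have hi : IntervalIntegrable (fun φ => capProfile (κ * Real.cos φ)) MeasureTheory.volume 0 β' :=
      (continuous_capProfile.comp (by fun_prop)).intervalIntegrable _ _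
    rw [intervalIntegral.integral_sub (by simp) hi]
    have := hle β' hβ'0 hββ hs hκ hcos
    simp only [intervalIntegral.integral_const, sub_zero, smul_eq_mul]
    linarith
  linarith

lemma measurable_arcDefect (M c κ ψ : ℝ) : Measurable (arcDefect M c κ ψ) := by
  unfold arcDefect
  refine Measurable.ite (measurableSet_lt (by fun_prop) (by fun_prop)) ?_ measurable_const
  exact measurable_const.sub (continuous_capProfile.measurable.comp (by fun_prop))

lemma integral_slice {G : ℝ} (hG : 0 ≤ G) :
    ∫ r in (0 : ℝ)..(1 / √(1 + G ^ 2)), r * (√(1 - r ^ 2) - r * G) = capProfile G / 3 := by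
  set S := √(1 + G ^ 2) with hS
  have hS0 : 0 < S := by positivity
  have hS2 : S ^ 2 = 1 + G ^ 2 := Real.sq_sqrt (by positivity)
  have hS1 : 1 ≤ S := by nlinarith
  have hr1 : 1 / S ≤ 1 := (div_le_one hS0).2 hS1
  rw [intervalIntegral.integral_eq_sub_of_hasDerivAt_of_le
    (f := fun r => -((1 - r ^ 2) * √(1 - r ^ 2) + r ^ 3 * G) / 3) (by positivity)]
  · have e : 1 - (1 / S) ^ 2 = (G / S) ^ 2 := by
      field_simp
      linarith
    rw [e, Real.sqrt_sq (by positivity)]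
    unfold capProfile
    rw [← hS]
    simp only [ne_eq, OfNat.ofNat_ne_zero, not_false_eq_true, zero_pow, sub_zero, Real.sqrt_one]
    field_simp
    linear_combination G * hS2
  · fun_prop
  · intro r hr
    have hp : 0 < 1 - r ^ 2 := by nlinarith [hr.1, hr.2]
    have h1 : HasDerivAt (fun r : ℝ => 1 - r ^ 2) (-(2 * r)) r := by
      simpa using (hasDerivAt_pow 2 r).const_sub 1
    have h2 := h1.sqrt hp.ne'
    have h3 : HasDerivAt (fun r : ℝ => r ^ 3 * G) (3 * r ^ 2 * G) r := by
      simpa using (hasDerivAt_pow 3 r).mul_const G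
    convert! (((h1.mul h2).add h3).neg.div_const 3) using 1
    have hq : 0 < √(1 - r ^ 2) := Real.sqrt_pos.2 hp
    have hq2 : √(1 - r ^ 2) ^ 2 = 1 - r ^ 2 := Real.sq_sqrt hp.le
    field_simp
    linear_combination r * hq2
  · exact Continuous.intervalIntegrable (by fun_prop) _ _

open MeasureTheory in
lemma measurePreserving_cylinder :
    MeasurePreserving (fun p : (ℝ × ℝ) × ℝ => (!₂[p.1.1, p.1.2, p.2] : E3)) := by
  have h1 := (volume_preserving_piFinSuccAbove (fun _ : Fin 3 => ℝ) 2).symm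
  have h2 : MeasurePreserving (Prod.map (id : ℝ → ℝ) (MeasurableEquiv.finTwoArrow (α := ℝ)).symm)
      (volume.prod volume) (volume.prod volume) :=
    (MeasurePreserving.id volume).prod (volume_preserving_finTwoArrow ℝ).symm
  have h3 : MeasurePreserving (Prod.swap : (ℝ × ℝ) × ℝ → ℝ × (ℝ × ℝ))
      (volume.prod volume) (volume.prod volume) := Measure.measurePreserving_swap
  have h := (PiLp.volume_preserving_toLp (Fin 3)).comp (h1.comp (h2.comp h3))
  convert! h using 1
  funext p
  ext i
  fin_cases i <;> rfl

open MeasureTheory in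
lemma le_volume_of_polar {N : Set E3} (hN : MeasurableSet N) {G : ℝ → ℝ} (hGc : Continuous G)
    (hG : ∀ φ, 0 ≤ G φ)
    (h : ∀ r φ t : ℝ, 0 < r → r * G φ < t → r ^ 2 + t ^ 2 < 1 →
      !₂[r * Real.cos φ, r * Real.sin φ, t] ∈ N) :
    ENNReal.ofReal ((∫ φ in (-π)..π, capProfile (G φ)) / 3) ≤ volume N := by
  have hπ := Real.pi_pos
  have hslice : ∀ φ : ℝ, ENNReal.ofReal (capProfile (G φ) / 3) ≤
      ∫⁻ r in Set.Ioi (0 : ℝ), ENNReal.ofReal (r * (√(1 - r ^ 2) - r * G φ)) := by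
    intro φ
    have h0 : (0 : ℝ) ≤ 1 / √(1 + G φ ^ 2) := by positivity
    rw [← integral_slice (hG φ), intervalIntegral.integral_of_le h0,
      ofReal_integral_eq_lintegral_ofReal]
    · exact lintegral_mono_set Set.Ioc_subset_Ioi_self
    · exact (Continuous.integrableOn_Ioc (by fun_prop))
    · filter_upwards [ae_restrict_mem measurableSet_Ioc] with r hr
      have hS0 : 0 < √(1 + G φ ^ 2) := by positivity
      have hS2 : √(1 + G φ ^ 2) ^ 2 = 1 + G φ ^ 2 := Real.sq_sqrt (by positivity)
      have h1 : r * √(1 + G φ ^ 2) ≤ 1 := (le_div_iff₀ hS0).1 hr.2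
      have h2 : r ^ 2 * (1 + G φ ^ 2) ≤ 1 := by
        rw [← hS2, ← mul_pow]
        exact pow_le_one₀ (mul_nonneg hr.1.le hS0.le) h1
      apply mul_nonneg hr.1.le
      rw [sub_nonneg]
      apply Real.le_sqrt_of_sq_le
      linarith
  have hV : volume N = ∫⁻ p : ℝ × ℝ, volume {t : ℝ | !₂[p.1, p.2, t] ∈ N} := by
    rw [← measurePreserving_cylinder.measure_preimage hN.nullMeasurableSet, Measure.volume_eq_prod,
      Measure.prod_apply (measurePreserving_cylinder.measurable hN)]
    rfl
  rw [hV, ← lintegral_comp_polarCoord_symm]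
  calc ENNReal.ofReal ((∫ φ in (-π)..π, capProfile (G φ)) / 3)
      = ∫⁻ φ in Set.Ioo (-π) π, ENNReal.ofReal (capProfile (G φ) / 3) := by
        rw [← intervalIntegral.integral_div, intervalIntegral.integral_of_le (by linarith),
          integral_Ioc_eq_integral_Ioo, ofReal_integral_eq_lintegral_ofReal]
        · exact (((continuous_capProfile.comp hGc).div_const 3).integrableOn_Ioc).mono_set
            Set.Ioo_subset_Ioc_self
        · exact ae_of_all _ fun φ => div_nonneg (capProfile_nonneg _) (by norm_num)
    _ ≤ ∫⁻ φ in Set.Ioo (-π) π, ∫⁻ r in Set.Ioi (0 : ℝ),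
          ENNReal.ofReal (r * (√(1 - r ^ 2) - r * G φ)) := lintegral_mono fun φ => hslice φ
    _ = ∫⁻ p in polarCoord.target, ENNReal.ofReal (p.1 * (√(1 - p.1 ^ 2) - p.1 * G p.2)) := by
        rw [polarCoord_target, Measure.volume_eq_prod, ← Measure.prod_restrict,
          lintegral_prod_symm]
        exact (Continuous.measurable (by fun_prop)).ennreal_ofReal.aemeasurable
    _ ≤ _ := by
        apply setLIntegral_mono' polarCoord.open_target.measurableSet
        rintro ⟨r, φ⟩ hp
        have hr : 0 < r := hp.1
        rw [ENNReal.ofReal_mul hr.le, smul_eq_mul]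
        gcongr
        rw [← Real.volume_Ioo]
        apply measure_mono
        rintro t ⟨ht1, ht2⟩
        have ht0 : 0 ≤ t := (mul_nonneg hr.le (hG φ)).trans ht1.le
        have := (Real.lt_sqrt ht0).1 ht2
        exact h r φ t hr ht1 (by linarith)

lemma capProfile_le_two (y : ℝ) : capProfile y ≤ 2 := by
  have h := capProfile_nonneg (-y)
  unfold capProfile at h ⊢
  rw [neg_sq, neg_div] at h
  linarith

lemma intervalIntegrable_arcDefect (M c κ ψ a b : ℝ) :
    IntervalIntegrable (arcDefect M c κ ψ) MeasureTheory.volume a b := by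
  have hb : ∀ φ, ‖arcDefect M c κ ψ φ‖ ≤ |M| + 2 := by
    intro φ
    unfold arcDefect
    split_ifs
    · refine (norm_sub_le _ _).trans ?_
      rw [Real.norm_eq_abs, Real.norm_eq_abs, abs_of_nonneg (capProfile_nonneg _)]
      linarith [capProfile_le_two (κ * Real.cos (φ - ψ))]
    · rw [norm_zero]
      positivity
  exact (intervalIntegrable_const (c := |M| + 2)).mono_fun
    (measurable_arcDefect M c κ ψ).aestronglyMeasurable
    (MeasureTheory.ae_of_all _ fun φ => (hb φ).trans (le_abs_self _))

lemma exists_polar (x y : ℝ) : ∃ κ ψ : ℝ, 0 ≤ κ ∧ κ ^ 2 = x ^ 2 + y ^ 2 ∧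
    x = κ * Real.cos ψ ∧ y = κ * Real.sin ψ := by
  refine ⟨‖(⟨x, y⟩ : ℂ)‖, Complex.arg ⟨x, y⟩, norm_nonneg _, ?_, ?_, ?_⟩
  · rw [Complex.sq_norm, Complex.normSq_mk]; ring
  · rw [Complex.norm_mul_cos_arg]
  · rw [Complex.norm_mul_sin_arg]

lemma two_pi_mul_le_integral_capProfile {ι : Type*} (J : Finset ι) {s β : ℝ} {κ ψ : ι → ℝ}
    (hβ0 : 0 < β) (hβ : β ≤ π / 2) (hs : 0 ≤ s)
    (hκ0 : ∀ j ∈ J, 0 ≤ κ j) (hκs : ∀ j ∈ J, κ j ≤ s)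
    (hdisj : ∀ j ∈ J, ∀ j' ∈ J, ∀ φ, s * Real.cos β < κ j * Real.cos (φ - ψ j) →
      s * Real.cos β < κ j' * Real.cos (φ - ψ j') → j = j') :
    2 * π * ((∫ u in (0 : ℝ)..β, capProfile (s * Real.cos u)) / β) ≤
      ∫ φ in (-π)..π, capProfile (s * Real.cos β +
        ∑ j ∈ J, max 0 (κ j * Real.cos (φ - ψ j) - s * Real.cos β)) := by
  have hπ := Real.pi_pos
  have hdef := fun j hj => integral_arcDefect_nonpos (ψ := ψ j) hβ0 hβ (hκ0 j hj) (hκs j hj)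
  have hMc : (∫ u in (0 : ℝ)..β, capProfile (s * Real.cos u)) / β ≤
      capProfile (s * Real.cos β) := by
    rw [div_le_iff₀ hβ0]
    have : ∫ u in (0 : ℝ)..β, capProfile (s * Real.cos u) ≤
        ∫ _u in (0 : ℝ)..β, capProfile (s * Real.cos β) := by
      apply intervalIntegral.integral_mono_on hβ0.le
      · exact (continuous_capProfile.comp (by fun_prop)).intervalIntegrable _ _
      · simp
      · intro u hu
        apply capProfile_antitone
        gcongr
        exact Real.cos_le_cos_of_nonneg_of_le_pi hu.1 (by linarith) hu.2
    simpa [mul_comm] using this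
  set M := (∫ u in (0 : ℝ)..β, capProfile (s * Real.cos u)) / β with hM
  set c := s * Real.cos β with hc
  have hpt : ∀ φ, M - ∑ j ∈ J, arcDefect M c (κ j) (ψ j) φ ≤
      capProfile (c + ∑ j ∈ J, max 0 (κ j * Real.cos (φ - ψ j) - c)) := by
    intro φ
    by_cases hact : ∃ j ∈ J, c < κ j * Real.cos (φ - ψ j)
    · obtain ⟨j, hj, hlt⟩ := hact
      have hothers : ∀ j' ∈ J, j' ≠ j → ¬ c < κ j' * Real.cos (φ - ψ j') :=
        fun j' hj' hne h => hne (hdisj j' hj' j hj φ h hlt)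
      rw [Finset.sum_eq_single_of_mem j hj, Finset.sum_eq_single_of_mem j hj]
      · rw [max_eq_right (by linarith), arcDefect, if_pos hlt]
        simp
      · intro j' hj' hne
        exact max_eq_left (by linarith [not_lt.1 (hothers j' hj' hne)])
      · intro j' hj' hne
        exact if_neg (hothers j' hj' hne)
    · push Not at hact
      rw [Finset.sum_eq_zero, Finset.sum_eq_zero]
      · simpa using hMc
      · intro j hj
        exact max_eq_left (by linarith [hact j hj])
      · intro j hj
        exact if_neg (not_lt.2 (hact j hj))
  have hsumI : IntervalIntegrable (fun φ => ∑ j ∈ J, arcDefect M c (κ j) (ψ j) φ)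
      MeasureTheory.volume (-π) π := by
    have h := IntervalIntegrable.sum J (f := fun j => arcDefect M c (κ j) (ψ j))
      (fun j _ => intervalIntegrable_arcDefect M c (κ j) (ψ j) (-π) π)
    have h2 : (∑ j ∈ J, arcDefect M c (κ j) (ψ j)) =
        fun φ => ∑ j ∈ J, arcDefect M c (κ j) (ψ j) φ := by
      funext φ
      simp
    rwa [h2] at h
  have hI : ∫ φ in (-π)..π, (M - ∑ j ∈ J, arcDefect M c (κ j) (ψ j) φ) ≤
      ∫ φ in (-π)..π, capProfile (c + ∑ j ∈ J, max 0 (κ j * Real.cos (φ - ψ j) - c)) := by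
    apply intervalIntegral.integral_mono_on (by linarith)
    · refine IntervalIntegrable.sub (by simp) ?_
      exact hsumI
    · exact (continuous_capProfile.comp (by fun_prop)).intervalIntegrable _ _
    · exact fun φ _ => hpt φ
  refine le_trans ?_ hI
  rw [intervalIntegral.integral_sub (by simp), intervalIntegral.integral_finsetSum]
  · have : ∑ j ∈ J, ∫ φ in (-π)..π, arcDefect M c (κ j) (ψ j) φ ≤ 0 :=
      Finset.sum_nonpos hdef
    simp only [intervalIntegral.integral_const, smul_eq_mul]
    linarith
  · exact fun j _ => intervalIntegrable_arcDefect _ _ _ _ _ _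
  · exact hsumI

lemma measurableSet_voronoi {ι : Type*} [Fintype ι] (P : ι → E3) (i : ι) :
    MeasurableSet (Metric.ball (0 : E3) 1 ∩
      {x | ∀ j, j ≠ i → inner ℝ (P j) x < inner ℝ (P i) x}) := by
  refine measurableSet_ball.inter ?_
  simp only [Set.ofPred_forall]
  exact MeasurableSet.iInter fun j => MeasurableSet.iInter fun _ =>
    measurableSet_lt (by fun_prop) (by fun_prop)

open MeasureTheory in
/-- The part of the unit ball in the open Voronoi cone of the point `P i` is at least as large as
its model value, when the points have pairwise inner products at most `2 K² - 1`. -/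
lemma le_volume_voronoi {ι : Type*} [Fintype ι] {P : ι → E3} (hP : ∀ i, ‖P i‖ = 1)
    {K β s : ℝ} (hK : 1 / 2 ≤ K) (hK1 : K < 1) (hβ0 : 0 < β) (hβ : β ≤ π / 2)
    (hKβ : K * Real.sin β = 1 / 2) (hs : s = K / √(1 - K ^ 2))
    (hsep : ∀ i j, i ≠ j → inner ℝ (P i) (P j) ≤ 2 * K ^ 2 - 1) (i : ι) :
    ENNReal.ofReal (2 * π * ((∫ u in (0 : ℝ)..β, capProfile (s * Real.cos u)) / β) / 3) ≤
      volume (Metric.ball (0 : E3) 1 ∩ {x | ∀ j, j ≠ i → inner ℝ (P j) x < inner ℝ (P i) x}) := by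
  classical
  have hK2 : 0 < 1 - K ^ 2 := by nlinarith
  have hs0 : 0 ≤ s := by rw [hs]; positivity
  have hs2 : s ^ 2 * (1 - K ^ 2) = K ^ 2 := by
    rw [hs, div_pow, Real.sq_sqrt hK2.le]; field_simp
  have hcβ : 0 ≤ Real.cos β :=
    Real.cos_nonneg_of_neg_pi_div_two_le_of_le (by linarith) (by linarith)
  have hc0 : 0 ≤ s * Real.cos β := mul_nonneg hs0 hcβ
  have hc2 : (s * Real.cos β) ^ 2 * (1 - K ^ 2) = K ^ 2 - 1 / 4 := by
    have h1 : K ^ 2 * Real.sin β ^ 2 = 1 / 4 := by rw [← mul_pow, hKβ]; norm_num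
    have h2 := Real.sin_sq_add_cos_sq β
    rw [mul_pow]
    linear_combination Real.cos β ^ 2 * hs2 + K ^ 2 * h2 - h1
  obtain ⟨b, hb⟩ := Orthonormal.exists_orthonormalBasis_extension_of_card_eq (𝕜 := ℝ) (E := E3)
    (ι := Fin 3) (by simp) (v := fun _ => P i) (s := {2})
    (by rw [orthonormal_iff_ite]; rintro ⟨x, rfl⟩ ⟨y, rfl⟩; simp [hP])
  have hb2 : b 2 = P i := hb 2 rfl
  have hexp : ∀ v w : E3, inner ℝ v w = inner ℝ v (b 0) * inner ℝ w (b 0) +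
      inner ℝ v (b 1) * inner ℝ w (b 1) + inner ℝ v (b 2) * inner ℝ w (b 2) := by
    intro v w
    rw [← b.sum_inner_mul_inner v w, Fin.sum_univ_three, real_inner_comm (b 0) w,
      real_inner_comm (b 1) w, real_inner_comm (b 2) w]
  have hlt1 : ∀ j, j ≠ i → inner ℝ (P j) (b 2) ≤ 2 * K ^ 2 - 1 := by
    intro j hj
    rw [hb2]
    exact hsep j i hj
  have hsq : ∀ j, inner ℝ (P j) (b 0) ^ 2 + inner ℝ (P j) (b 1) ^ 2 + inner ℝ (P j) (b 2) ^ 2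
      = (1 : ℝ) := by
    intro j
    have h1 := hexp (P j) (P j)
    rw [real_inner_self_eq_norm_sq, hP] at h1
    linarith
  choose κ ψ hκ0 hκ2 hκc hκs using fun j => exists_polar
    (inner ℝ (P j) (b 0) / (1 - inner ℝ (P j) (b 2)))
    (inner ℝ (P j) (b 1) / (1 - inner ℝ (P j) (b 2)))
  have hcos : ∀ j, j ≠ i → ∀ φ, κ j * Real.cos (φ - ψ j) * (1 - inner ℝ (P j) (b 2)) =
      Real.cos φ * inner ℝ (P j) (b 0) + Real.sin φ * inner ℝ (P j) (b 1) := by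
    intro j hj φ
    have hpos : 0 < 1 - inner ℝ (P j) (b 2) := by nlinarith [hlt1 j hj]
    have h1 := hκc j
    have h2 := hκs j
    rw [div_eq_iff hpos.ne'] at h1 h2
    rw [Real.cos_sub, h1, h2]
    ring
  have hκle : ∀ j, j ≠ i → κ j ≤ s := by
    intro j hj
    have hpos : 0 < 1 - inner ℝ (P j) (b 2) := by nlinarith [hlt1 j hj]
    have h1 : κ j ^ 2 * (1 - inner ℝ (P j) (b 2)) = 1 + inner ℝ (P j) (b 2) := by
      have h2 := hκ2 j
      rw [div_pow, div_pow, ← add_div, eq_div_iff (by positivity)] at h2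
      have h3 := hsq j
      apply mul_right_cancel₀ hpos.ne'
      linear_combination h2 + h3
    have h4 := hlt1 j hj
    refine le_of_sq_le_sq ?_ hs0
    have h5 : κ j ^ 2 * (2 * (1 - K ^ 2)) ≤ s ^ 2 * (2 * (1 - K ^ 2)) := by
      nlinarith [sq_nonneg (κ j)]
    exact le_of_mul_le_mul_right h5 (by linarith)
  have hdisj : ∀ j ∈ Finset.univ.erase i, ∀ j' ∈ Finset.univ.erase i, ∀ φ,
      s * Real.cos β < κ j * Real.cos (φ - ψ j) →
      s * Real.cos β < κ j' * Real.cos (φ - ψ j') → j = j' := by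
    intro j hj j' hj' φ h1 h2
    by_contra hne
    have hj := Finset.ne_of_mem_erase hj
    have hj' := Finset.ne_of_mem_erase hj'
    set c := s * Real.cos β with hc
    set x : E3 := Real.cos φ • b 0 + Real.sin φ • b 1 + c • b 2 with hx
    have hb' := b.orthonormal
    have hbij : ∀ k l, inner ℝ (b k) (b l) = if k = l then (1 : ℝ) else 0 :=
      orthonormal_iff_ite.1 hb'
    have hin : ∀ v : E3, inner ℝ v x = Real.cos φ * inner ℝ v (b 0) +
        Real.sin φ * inner ℝ v (b 1) + c * inner ℝ v (b 2) := by
      intro v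
      simp only [hx, inner_add_right, inner_smul_right]
    have hact : ∀ l, l ≠ i → c < κ l * Real.cos (φ - ψ l) → c < inner ℝ (P l) x := by
      intro l hl hlt
      have hpos : 0 < 1 - inner ℝ (P l) (b 2) := by nlinarith [hlt1 l hl]
      rw [hin, ← hcos l hl φ]
      nlinarith
    have hxx : ‖x‖ ^ 2 = 1 + c ^ 2 := by
      rw [← real_inner_self_eq_norm_sq, hin, real_inner_comm, real_inner_comm (b 1),
        real_inner_comm (b 2), hin, hin, hin]
      simp only [hbij]
      have := Real.sin_sq_add_cos_sq φ
      simp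
      linear_combination this
    have hix : inner ℝ (P i) x = c := by
      rw [← hb2, hin]
      simp [hbij]
    have e1 := hact j hj h1
    have e2 := hact j' hj' h2
    have hsum : 3 * c < inner ℝ (P i + P j + P j') x := by
      rw [inner_add_left, inner_add_left, hix]
      linarith
    have hnorm : ‖P i + P j + P j'‖ ^ 2 ≤ 3 + 6 * (2 * K ^ 2 - 1) := by
      rw [← real_inner_self_eq_norm_sq]
      simp only [inner_add_left, inner_add_right]
      simp only [real_inner_self_eq_norm_sq, hP]
      have a1 := hsep i j hj.symm
      have a2 := hsep i j' hj'.symm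
      have a3 := hsep j j' hne
      have a4 := real_inner_comm (P i) (P j)
      have a5 := real_inner_comm (P i) (P j')
      have a6 := real_inner_comm (P j) (P j')
      linarith
    have hCS := real_inner_le_norm (P i + P j + P j') x
    have h9 : (3 * c) ^ 2 < (‖P i + P j + P j'‖ * ‖x‖) ^ 2 :=
      pow_lt_pow_left₀ (hsum.trans_le hCS) (by positivity) (by norm_num)
    rw [mul_pow ‖P i + P j + P j'‖, hxx] at h9
    have h10 : (3 * c) ^ 2 < (3 + 6 * (2 * K ^ 2 - 1)) * (1 + c ^ 2) :=
      h9.trans_le (by gcongr)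
    nlinarith
  have hmain := two_pi_mul_le_integral_capProfile (Finset.univ.erase i) (ψ := ψ) hβ0 hβ hs0
    (fun j _ => hκ0 j) (fun j hj => hκle j (Finset.ne_of_mem_erase hj)) hdisj
  have hmp := b.repr.symm.measurePreserving
  have hmeas := measurableSet_voronoi P i
  rw [← hmp.measure_preimage hmeas.nullMeasurableSet]
  refine le_trans (ENNReal.ofReal_le_ofReal ?_)
    (le_volume_of_polar (hmp.measurable hmeas) (G := fun φ => s * Real.cos β +
      ∑ j ∈ Finset.univ.erase i, max 0 (κ j * Real.cos (φ - ψ j) - s * Real.cos β))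
      (by fun_prop) (fun φ => add_nonneg hc0 (Finset.sum_nonneg fun j _ => le_max_left _ _)) ?_)
  · gcongr
  · intro r φ t hr hrt hrt1
    refine ⟨?_, ?_⟩
    · rw [mem_ball_zero_iff, LinearIsometryEquiv.norm_map, EuclideanSpace.norm_eq,
        Real.sqrt_lt' one_pos, Fin.sum_univ_three]
      simp only [Real.norm_eq_abs, sq_abs]
      have := Real.sin_sq_add_cos_sq φ
      change (r * Real.cos φ) ^ 2 + (r * Real.sin φ) ^ 2 + t ^ 2 < 1 ^ 2
      calc _ = r ^ 2 * (Real.sin φ ^ 2 + Real.cos φ ^ 2) + t ^ 2 := by ring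
        _ < 1 ^ 2 := by rw [this]; linarith
    · intro j hj
      have hx : ∀ v : E3, inner ℝ v (b.repr.symm !₂[r * Real.cos φ, r * Real.sin φ, t]) =
          r * (Real.cos φ * inner ℝ v (b 0) + Real.sin φ * inner ℝ v (b 1)) +
            t * inner ℝ v (b 2) := by
        intro v
        rw [← b.sum_repr_symm, Fin.sum_univ_three]
        simp only [inner_add_right, inner_smul_right, Matrix.cons_val]
        ring
      have hb' := orthonormal_iff_ite.1 b.orthonormal
      rw [hx, hx, ← hcos j hj φ]
      have e1 : inner ℝ (P i) (b 0) = (0 : ℝ) := by rw [← hb2, hb']; simp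
      have e2 : inner ℝ (P i) (b 1) = (0 : ℝ) := by rw [← hb2, hb']; simp
      have e3 : inner ℝ (P i) (b 2) = (1 : ℝ) := by rw [← hb2, hb']; simp
      rw [e1, e2, e3]
      have hpos : 0 < 1 - inner ℝ (P j) (b 2) := by nlinarith [hlt1 j hj]
      have hGe : κ j * Real.cos (φ - ψ j) ≤ s * Real.cos β +
          ∑ j ∈ Finset.univ.erase i, max 0 (κ j * Real.cos (φ - ψ j) - s * Real.cos β) := by
        have h1 := Finset.single_le_sum
          (f := fun j => max 0 (κ j * Real.cos (φ - ψ j) - s * Real.cos β))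
          (fun j _ => le_max_left _ _) (Finset.mem_erase.2 ⟨hj, Finset.mem_univ j⟩)
        have h2 := le_max_right 0 (κ j * Real.cos (φ - ψ j) - s * Real.cos β)
        linarith
      have h3 : r * (κ j * Real.cos (φ - ψ j)) < t :=
        (mul_le_mul_of_nonneg_left hGe hr.le).trans_lt hrt
      nlinarith

open MeasureTheory in
lemma card_mul_one_sub_le {n : ℕ} {P : Fin n → E3} (hP : ∀ i, ‖P i‖ = 1)
    {K β : ℝ} (hK : 1 / 2 ≤ K) (hK1 : K < 1) (hβ0 : 0 < β) (hβ : β ≤ π / 2)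
    (hKβ : K * Real.sin β = 1 / 2)
    (hsep : ∀ i j, i ≠ j → inner ℝ (P i) (P j) ≤ 2 * K ^ 2 - 1) :
    n * (1 - π / (6 * β)) ≤ 2 := by
  have hπ := Real.pi_pos
  have hK0 : 0 < K := by linarith
  have hI := integral_capProfile (β := β) hK0 hK1 rfl
  have has : Real.arcsin (1 / 2) = π / 6 := by
    rw [← Real.sin_pi_div_six, Real.arcsin_sin (by linarith) (by linarith)]
  rw [hKβ, has] at hI
  set C : Fin n → Set E3 := fun i => Metric.ball (0 : E3) 1 ∩
    {x | ∀ j, j ≠ i → inner ℝ (P j) x < inner ℝ (P i) x} with hC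
  have hle : ∀ i, ENNReal.ofReal (2 * π * ((β - π / 6) / β) / 3) ≤ volume (C i) := by
    intro i
    have h := le_volume_voronoi hP hK hK1 hβ0 hβ hKβ rfl hsep i
    rwa [hI] at h
  have hdisj : Set.PairwiseDisjoint ((Finset.univ : Finset (Fin n)) : Set (Fin n)) C := by
    intro i _ j _ hij
    refine Set.disjoint_left.2 fun x hx hy => ?_
    exact lt_asymm (hx.2 j hij.symm) (hy.2 i hij)
  have hsum := measure_biUnion_finset (μ := volume) hdisj fun i _ => measurableSet_voronoi P i
  have hball : volume (⋃ i ∈ Finset.univ, C i) ≤ volume (Metric.ball (0 : E3) 1) :=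
    measure_mono (Set.iUnion₂_subset fun i _ => Set.inter_subset_left)
  rw [hsum, EuclideanSpace.volume_ball_fin_three] at hball
  have h1 : (n : ENNReal) * ENNReal.ofReal (2 * π * ((β - π / 6) / β) / 3) ≤
      ENNReal.ofReal (π * 4 / 3) := by
    calc _ = ∑ _i : Fin n, ENNReal.ofReal (2 * π * ((β - π / 6) / β) / 3) := by simp
      _ ≤ ∑ i, volume (C i) := Finset.sum_le_sum fun i _ => hle i
      _ ≤ _ := hball.trans (by simp)
  rw [← ENNReal.ofReal_natCast, ← ENNReal.ofReal_mul (by positivity),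
    ENNReal.ofReal_le_ofReal_iff (by positivity)] at h1
  have h2 : (1 - π / (6 * β)) = (β - π / 6) / β := by field_simp
  rw [h2]
  refine le_of_mul_le_mul_left ?_ (show 0 < 2 * π / 3 by positivity)
  linarith

/-- Fejes Tóth's bound for the minimal distance of at least three points on the unit sphere. -/
lemma sq_le_of_le_dist {n : ℕ} (hn : 3 ≤ n) {P : Fin n → E3} (hP : ∀ i, ‖P i‖ = 1)
    {a : ℝ} (ha : 0 ≤ a) (hsep : ∀ i j, i ≠ j → a ≤ dist (P i) (P j)) :
    a ^ 2 ≤ 4 - 1 / Real.sin (π / 6 * (n / (n - 2))) ^ 2 := by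
  have hπ := Real.pi_pos
  have hn' : (3 : ℝ) ≤ n := by exact_mod_cast hn
  set Θ : ℝ := π / 6 * (n / (n - 2)) with hΘ
  have hq1 : 1 ≤ (n : ℝ) / (n - 2) := by
    rw [le_div_iff₀ (by linarith)]; linarith
  have hq3 : (n : ℝ) / (n - 2) ≤ 3 := by
    rw [div_le_iff₀ (by linarith)]; linarith
  have hΘ1 : π / 6 ≤ Θ := by rw [hΘ]; nlinarith
  have hΘ2 : Θ ≤ π / 2 := by rw [hΘ]; nlinarith
  have hs1 : 1 / 2 ≤ Real.sin Θ := by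
    rw [← Real.sin_pi_div_six]
    exact Real.sin_le_sin_of_le_of_le_pi_div_two (by linarith) hΘ2 hΘ1
  have hs2 : 1 / Real.sin Θ ^ 2 ≤ 4 := by
    rw [div_le_iff₀ (by positivity)]; nlinarith
  rcases ha.eq_or_lt with rfl | ha
  · linarith
  have hin : ∀ i j, i ≠ j → inner ℝ (P i) (P j) ≤ 1 - a ^ 2 / 2 := by
    intro i j hij
    have h1 := hsep i j hij
    have h2 : dist (P i) (P j) ^ 2 = 2 - 2 * inner ℝ (P i) (P j) := by
      rw [dist_eq_norm, norm_sub_sq_real, hP, hP]; ring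
    have h3 : a ^ 2 ≤ dist (P i) (P j) ^ 2 := by gcongr
    linarith
  have ha3 : a ^ 2 ≤ 3 := by
    have h1 := hin ⟨0, by lia⟩ ⟨1, by lia⟩ (by simp)
    have h2 := hin ⟨0, by lia⟩ ⟨2, by lia⟩ (by simp)
    have h3 := hin ⟨1, by lia⟩ ⟨2, by lia⟩ (by simp)
    have h4 : 0 ≤ ‖P ⟨0, by lia⟩ + P ⟨1, by lia⟩ + P ⟨2, by lia⟩‖ ^ 2 := by positivity
    rw [norm_add_sq_real, norm_add_sq_real, inner_add_left, hP, hP, hP] at h4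
    linarith
  set K := √(1 - a ^ 2 / 4) with hK
  have hK2 : K ^ 2 = 1 - a ^ 2 / 4 := Real.sq_sqrt (by linarith)
  have hKh : 1 / 2 ≤ K := Real.le_sqrt_of_sq_le (by linarith)
  have hK1 : K < 1 := by
    rw [hK, Real.sqrt_lt' one_pos]; nlinarith
  have hinv : 1 / (2 * K) ≤ 1 := by rw [div_le_one (by linarith)]; linarith
  have hinv0 : 0 < 1 / (2 * K) := by positivity
  set β := Real.arcsin (1 / (2 * K)) with hβdef
  have hsinβ : Real.sin β = 1 / (2 * K) := Real.sin_arcsin (by linarith) hinv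
  have hβ0 : 0 < β := Real.arcsin_pos.2 hinv0
  have hβ2 : β ≤ π / 2 := Real.arcsin_le_pi_div_two _
  have hcard := card_mul_one_sub_le hP hKh hK1 hβ0 hβ2 (by rw [hsinβ]; field_simp)
    (fun i j hij => (hin i j hij).trans (by rw [hK2]; linarith))
  have hβΘ : β ≤ Θ := by
    have h1 : (n : ℝ) * (6 * β - π) ≤ 2 * (6 * β) := by
      have : (n : ℝ) * (6 * β - π) = n * (1 - π / (6 * β)) * (6 * β) := by field_simp
      rw [this]
      gcongr
    rw [hΘ, ← mul_div_assoc, le_div_iff₀ (by linarith)]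
    linarith
  have hle : 1 / (2 * K) ≤ Real.sin Θ := by
    rw [← hsinβ]
    exact Real.sin_le_sin_of_le_of_le_pi_div_two (by linarith) hΘ2 hβΘ
  rw [div_le_iff₀ (by linarith)] at hle
  have h5 : 1 / Real.sin Θ ^ 2 ≤ 4 * K ^ 2 := by
    rw [div_le_iff₀ (by positivity)]; nlinarith
  linarith

lemma dSphere_set_nonneg {k : ℕ} {x : ℝ} (hx : x ∈ {x : ℝ | ∃ P : Fin k → E3, (∀ i, ‖P i‖ = 1) ∧
    x = sInf {d : ℝ | ∃ i j : Fin k, i ≠ j ∧ d = dist (P i) (P j)}}) : 0 ≤ x := by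
  obtain ⟨P, -, rfl⟩ := hx
  apply Real.sInf_nonneg
  rintro d ⟨i, j, -, rfl⟩
  exact dist_nonneg

lemma dSphere_nonneg (k : ℕ) : 0 ≤ dSphere k :=
  Real.sSup_nonneg fun _ => dSphere_set_nonneg

lemma dSphere_sq_le {k : ℕ} (hk : 3 ≤ k) :
    dSphere k ^ 2 ≤ 4 - 1 / Real.sin (π / 6 * (k / (k - 2))) ^ 2 := by
  set R := 4 - 1 / Real.sin (π / 6 * (k / (k - 2))) ^ 2
  have hmem : ∀ x ∈ {x : ℝ | ∃ P : Fin k → E3, (∀ i, ‖P i‖ = 1) ∧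
      x = sInf {d : ℝ | ∃ i j : Fin k, i ≠ j ∧ d = dist (P i) (P j)}}, x ^ 2 ≤ R := by
    intro x hx
    have h0 := dSphere_set_nonneg hx
    obtain ⟨P, hP, rfl⟩ := hx
    refine sq_le_of_le_dist hk hP h0 fun i j hij => csInf_le ⟨0, ?_⟩ ⟨i, j, hij, rfl⟩
    rintro d ⟨i, j, -, rfl⟩
    exact dist_nonneg
  have hne : Set.Nonempty {x : ℝ | ∃ P : Fin k → E3, (∀ i, ‖P i‖ = 1) ∧
      x = sInf {d : ℝ | ∃ i j : Fin k, i ≠ j ∧ d = dist (P i) (P j)}} :=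
    ⟨_, fun _ => EuclideanSpace.single 0 1, by simp, rfl⟩
  obtain ⟨x, hx⟩ := hne
  have hR : 0 ≤ R := (sq_nonneg x).trans (hmem x hx)
  have h1 : dSphere k ≤ √R := csSup_le ⟨x, hx⟩ fun y hy => Real.le_sqrt_of_sq_le (hmem y hy)
  calc dSphere k ^ 2 ≤ √R ^ 2 := by gcongr; exact dSphere_nonneg k
    _ = R := Real.sq_sqrt hR

lemma sin_div_sin_le_dSphere {m k : ℕ} (hk : m + 4 = 2 * k) :
    Real.sin (π / 5) / Real.sin (π / 6 * ((m : ℝ) + 4) / m) ≤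
      2 * Real.sin (π / 5) * √(1 - dSphere k ^ 2 / 4) := by
  have hπ := Real.pi_pos
  have h36 : 0 < Real.sin (π / 5) := Real.sin_pos_of_pos_of_lt_pi (by linarith) (by linarith)
  rcases Nat.eq_zero_or_pos m with rfl | hm
  · simp only [Nat.cast_zero, div_zero, Real.sin_zero]
    positivity
  have hk3 : 3 ≤ k := by lia
  have hk' : (m : ℝ) = 2 * k - 4 := by
    have : (m : ℝ) + 4 = 2 * k := by exact_mod_cast hk
    linarith
  have hk3' : (3 : ℝ) ≤ k := by exact_mod_cast hk3
  have harg : π / 6 * ((m : ℝ) + 4) / m = π / 6 * (k / (k - 2)) := by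
    have h2 : (k : ℝ) - 2 ≠ 0 := by linarith
    have h3 : (2 * k : ℝ) - 4 ≠ 0 := by linarith
    rw [hk']
    field_simp
    ring
  have hd := dSphere_sq_le hk3
  rw [harg]
  set σ := Real.sin (π / 6 * (k / (k - 2))) with hσ
  have hσ0 : 0 ≤ σ := by
    apply Real.sin_nonneg_of_nonneg_of_le_pi
    · have : (0 : ℝ) ≤ k / (k - 2) := div_nonneg (by linarith) (by linarith)
      positivity
    · have : (k : ℝ) / (k - 2) ≤ 3 := by
        rw [div_le_iff₀ (by linarith)]; linarith
      nlinarith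
  have h1 : 1 / (2 * σ) ≤ √(1 - dSphere k ^ 2 / 4) := by
    apply Real.le_sqrt_of_sq_le
    have : (1 / (2 * σ)) ^ 2 = 1 / σ ^ 2 / 4 := by ring
    rw [this]
    linarith
  calc Real.sin (π / 5) / σ = 2 * Real.sin (π / 5) * (1 / (2 * σ)) := by ring
    _ ≤ _ := by gcongr

lemma mem_convexHull_triple {a b c x : E3} : x ∈ convexHull ℝ ({a, b, c} : Set E3) ↔
    ∃ α β γ : ℝ, 0 ≤ α ∧ 0 ≤ β ∧ 0 ≤ γ ∧ α + β + γ = 1 ∧ α • a + β • b + γ • c = x := by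
  constructor
  · intro hx
    refine convexHull_min (t := {x : E3 | ∃ α β γ : ℝ, 0 ≤ α ∧ 0 ≤ β ∧ 0 ≤ γ ∧ α + β + γ = 1 ∧
      α • a + β • b + γ • c = x}) ?_ ?_ hx
    · rintro y (rfl | rfl | rfl)
      · exact ⟨1, 0, 0, by simp⟩
      · exact ⟨0, 1, 0, by simp⟩
      · exact ⟨0, 0, 1, by simp⟩
    · rintro _ ⟨α, β, γ, hα, hβ, hγ, hs, rfl⟩ _ ⟨α', β', γ', hα', hβ', hγ', hs', rfl⟩ s t hs0 ht0 hst
      refine ⟨s * α + t * α', s * β + t * β', s * γ + t * γ', by positivity, by positivity,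
        by positivity, by linear_combination s * hs + t * hs' + hst, by module⟩
  · rintro ⟨α, β, γ, hα, hβ, hγ, hs, rfl⟩
    have hc := convex_convexHull ℝ ({a, b, c} : Set E3)
    have h := hc.sum_mem (t := Finset.univ) (w := ![α, β, γ]) (z := ![a, b, c])
      (by intro i _; fin_cases i <;> simpa) (by simpa [Fin.sum_univ_three] using hs)
      (by intro i _; apply subset_convexHull; fin_cases i <;> simp)
    simpa [Fin.sum_univ_three] using h

lemma mem_convexHull_or_inner_lt {V : Set E3} {u : E3} {r : ℝ} (h : ∀ w ∈ V, inner ℝ u w ≤ r)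
    {x : E3} (hx : x ∈ convexHull ℝ V) :
    (inner ℝ u x = r ∧ x ∈ convexHull ℝ {w ∈ V | inner ℝ u w = r}) ∨ inner ℝ u x < r := by
  refine convexHull_min (t := {x | (inner ℝ u x = r ∧
    x ∈ convexHull ℝ {w ∈ V | inner ℝ u w = r}) ∨ inner ℝ u x < r}) ?_ ?_ hx
  · intro w hw
    rcases (h w hw).eq_or_lt with he | hlt
    · exact Or.inl ⟨he, subset_convexHull ℝ _ ⟨hw, he⟩⟩
    · exact Or.inr hlt
  · intro y hy z hz s t hs ht hst
    have hin : inner ℝ u (s • y + t • z) = s * inner ℝ u y + t * inner ℝ u z := by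
      rw [inner_add_right, inner_smul_right, inner_smul_right]
    have hr : s * r + t * r = r := by rw [← add_mul, hst, one_mul]
    have hy' : inner ℝ u y ≤ r := by rcases hy with hy | hy; exacts [hy.1.le, hy.le]
    have hz' : inner ℝ u z ≤ r := by rcases hz with hz | hz; exacts [hz.1.le, hz.le]
    rcases hs.eq_or_lt with rfl | hs0
    · obtain rfl : t = 1 := by linarith
      simpa using hz
    rcases ht.eq_or_lt with rfl | ht0
    · obtain rfl : s = 1 := by linarith
      simpa using hy
    rcases hy with hy | hy
    · rcases hz with hz | hz
      · refine Or.inl ⟨?_, convex_convexHull ℝ _ hy.2 hz.2 hs ht hst⟩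
        rw [hin, hy.1, hz.1, ← add_mul, hst, one_mul]
      · right
        change inner ℝ u (s • y + t • z) < r
        rw [hin]
        have h1 : s * inner ℝ u y ≤ s * r := by gcongr
        have h2 : t * inner ℝ u z < t * r := by gcongr
        linarith
    · right
      change inner ℝ u (s • y + t • z) < r
      rw [hin]
      have h1 : s * inner ℝ u y < s * r := by gcongr
      have h2 : t * inner ℝ u z ≤ t * r := by gcongr
      linarith

lemma inner_le_of_mem_convexHull {V : Set E3} {u : E3} {r : ℝ} (h : ∀ w ∈ V, inner ℝ u w ≤ r)
    {x : E3} (hx : x ∈ convexHull ℝ V) : inner ℝ u x ≤ r := by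
  rcases mem_convexHull_or_inner_lt h hx with h | h
  exacts [h.1.le, h.le]

lemma inner_eq_of_mem_convexHull {V : Set E3} {u : E3} {r : ℝ} {x : E3}
    (hx : x ∈ convexHull ℝ {w ∈ V | inner ℝ u w = r}) : inner ℝ u x = r := by
  refine le_antisymm (inner_le_of_mem_convexHull (fun w hw => hw.2.le) hx) ?_
  have h := inner_le_of_mem_convexHull (u := -u) (r := -r)
    (fun w hw => by rw [inner_neg_left, hw.2]) hx
  rw [inner_neg_left] at h
  linarith

lemma isExtreme_convexHull_sep {V : Set E3} {u : E3} {r : ℝ} (h : ∀ w ∈ V, inner ℝ u w ≤ r) :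
    IsExtreme ℝ (convexHull ℝ V) (convexHull ℝ {w ∈ V | inner ℝ u w = r}) := by
  refine ⟨convexHull_mono (Set.sep_subset _ _), ?_⟩
  rintro x hx y hy z hz ⟨s, t, hs, ht, hst, rfl⟩
  have hz' := inner_eq_of_mem_convexHull hz
  rw [inner_add_right, inner_smul_right, inner_smul_right] at hz'
  rcases mem_convexHull_or_inner_lt h hx with hx' | hx'
  · exact hx'.2
  · exfalso
    have hy' := inner_le_of_mem_convexHull h hy
    have h1 : s * inner ℝ u x < s * r := by gcongr
    have h2 : t * inner ℝ u y ≤ t * r := by gcongr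
    have hr : s * r + t * r = r := by rw [← add_mul, hst, one_mul]
    linarith

lemma vectorSpan_convexHull (S : Set E3) : vectorSpan ℝ (convexHull ℝ S) = vectorSpan ℝ S := by
  rw [← direction_affineSpan, affineSpan_convexHull, direction_affineSpan]

lemma isFaceDim_convexHull_sep {V : Set E3} {u : E3} {r : ℝ} (h : ∀ w ∈ V, inner ℝ u w ≤ r)
    {d : ℕ} (hne : {w ∈ V | inner ℝ u w = r}.Nonempty)
    (hd : Module.finrank ℝ (vectorSpan ℝ {w ∈ V | inner ℝ u w = r}) = d) :
    IsFaceDim (convexHull ℝ V) (convexHull ℝ {w ∈ V | inner ℝ u w = r}) d :=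
  ⟨hne.convexHull, convex_convexHull _ _, isExtreme_convexHull_sep h, by
    rw [vectorSpan_convexHull, hd]⟩

lemma inner_eq_zero_of_mem_vectorSpan {S : Set E3} {u : E3} {r : ℝ}
    (h : ∀ w ∈ S, inner ℝ u w = r) {x : E3} (hx : x ∈ vectorSpan ℝ S) : inner ℝ u x = 0 := by
  refine Submodule.span_induction (p := fun x _ => inner ℝ u x = 0) ?_ (by simp) ?_ ?_ hx
  · rintro _ ⟨a, ha, b, hb, rfl⟩
    simp only [vsub_eq_sub]
    rw [inner_sub_right, h a ha, h b hb, sub_self]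
  · intro x y _ _ hx hy
    rw [inner_add_right, hx, hy, add_zero]
  · intro t x _ hx
    rw [inner_smul_right, hx, mul_zero]

lemma finrank_orthogonal_span {u : E3} (hu : u ≠ 0) :
    Module.finrank ℝ (ℝ ∙ u)ᗮ = 2 := by
  have : Fact (Module.finrank ℝ E3 = 2 + 1) := ⟨by simp⟩
  exact Submodule.finrank_orthogonal_span_singleton hu

lemma finrank_vectorSpan_le_two {S : Set E3} {u : E3} {r : ℝ} (hu : u ≠ 0)
    (h : ∀ w ∈ S, inner ℝ u w = r) : Module.finrank ℝ (vectorSpan ℝ S) ≤ 2 := by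
  rw [← finrank_orthogonal_span hu]
  refine Submodule.finrank_mono fun x hx => ?_
  rw [Submodule.mem_orthogonal_singleton_iff_inner_right]
  exact inner_eq_zero_of_mem_vectorSpan h hx

lemma linearIndependent_sub {a b c : E3} (habc : AffineIndependent ℝ ![a, b, c]) :
    LinearIndependent ℝ ![b - a, c - a] := by
  rw [affineIndependent_iff_linearIndependent_vsub ℝ _ (0 : Fin 3)] at habc
  have h := habc.comp (fun i : Fin 2 => (⟨i.succ, Fin.succ_ne_zero i⟩ : {x : Fin 3 // x ≠ 0}))
    (fun i j hij => by simpa using hij)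
  convert! h using 1
  funext i
  fin_cases i <;> rfl

/-- The points of the plane through an affinely independent triple. -/
lemma exists_normal {a b c : E3} (habc : AffineIndependent ℝ ![a, b, c]) :
    ∃ u : E3, u ≠ 0 ∧ inner ℝ u b = inner ℝ u a ∧ inner ℝ u c = inner ℝ u a ∧
      ∀ x, inner ℝ u x = inner ℝ u a →
        ∃ α β γ : ℝ, α + β + γ = 1 ∧ α • a + β • b + γ • c = x := by
  set W := Submodule.span ℝ {b - a, c - a} with hW
  have hli := linearIndependent_sub habc
  have hW2 : Module.finrank ℝ W = 2 := by
    have h := finrank_span_eq_card hli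
    rw [Matrix.range_cons, Matrix.range_cons, Matrix.range_empty, Set.union_empty,
      Set.singleton_union] at h
    simpa using h
  have hWo : Wᗮ ≠ ⊥ := by
    intro h0
    have h := Submodule.finrank_add_finrank_orthogonal W
    rw [hW2, h0, finrank_bot, finrank_euclideanSpace_fin] at h
    exact absurd h (by norm_num)
  obtain ⟨u, huW, hu0⟩ := Submodule.exists_mem_ne_zero_of_ne_bot hWo
  rw [Submodule.mem_orthogonal'] at huW
  have hb := huW (b - a) (Submodule.subset_span (by simp))
  have hc := huW (c - a) (Submodule.subset_span (by simp))
  rw [inner_sub_right, sub_eq_zero] at hb hc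
  refine ⟨u, hu0, hb, hc, fun x hx => ?_⟩
  have hle : W ≤ (ℝ ∙ u)ᗮ := fun y hy => by
    rw [Submodule.mem_orthogonal_singleton_iff_inner_right]
    exact huW y hy
  have heq : W = (ℝ ∙ u)ᗮ :=
    Submodule.eq_of_le_of_finrank_eq hle (by rw [hW2, finrank_orthogonal_span hu0])
  have hxW : x - a ∈ W := by
    rw [heq, Submodule.mem_orthogonal_singleton_iff_inner_right, inner_sub_right, hx, sub_self]
  obtain ⟨s, t, hst⟩ := Submodule.mem_span_pair.1 hxW
  refine ⟨1 - s - t, s, t, by ring, ?_⟩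
  rw [← sub_eq_zero] at hst ⊢
  rw [← hst]
  module

/-- A triangular face of a polytope is cut out by a supporting plane. -/
lemma exists_supporting {V : Set E3} (hV : ∀ v ∈ V, v ∈ Set.extremePoints ℝ (convexHull ℝ V))
    {a b c : E3} (habc : AffineIndependent ℝ ![a, b, c])
    (hF : IsExtreme ℝ (convexHull ℝ V) (convexHull ℝ {a, b, c})) :
    ∃ (u : E3) (r : ℝ), u ≠ 0 ∧ (∀ w ∈ V, inner ℝ u w ≤ r) ∧
      ∀ w ∈ V, inner ℝ u w = r ↔ w ∈ ({a, b, c} : Set E3) := by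
  obtain ⟨u, hu0, hub, huc, hu⟩ := exists_normal habc
  have hplane : ∀ x ∈ convexHull ℝ V, inner ℝ u x = inner ℝ u a →
      x ∈ convexHull ℝ ({a, b, c} : Set E3) := by
    intro x hx hxa
    obtain ⟨α, β, γ, hs, rfl⟩ := hu x hxa
    set ε : ℝ := 1 / (1 + 3 * (|α| + |β| + |γ|)) with hε
    have hD : 0 < 1 + 3 * (|α| + |β| + |γ|) := by positivity
    have hε0 : 0 < ε := by positivity
    have hε1 : ε * (1 + 3 * (|α| + |β| + |γ|)) = 1 := by rw [hε]; field_simp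
    have key : ∀ l : ℝ, |l| ≤ |α| + |β| + |γ| → 0 ≤ 1 / 3 + ε * (1 / 3 - l) := by
      intro l hl
      have h1 : ε * l ≤ ε * (|α| + |β| + |γ|) := by
        gcongr
        exact (le_abs_self l).trans hl
      nlinarith
    have hz : (1 / 3 : ℝ) • a + (1 / 3 : ℝ) • b + (1 / 3 : ℝ) • c ∈
        convexHull ℝ ({a, b, c} : Set E3) :=
      mem_convexHull_triple.2 ⟨_, _, _, by norm_num, by norm_num, by norm_num, by norm_num, rfl⟩
    have hf0 : (1 / 3 + ε * (1 / 3 - α)) • a + (1 / 3 + ε * (1 / 3 - β)) • b +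
        (1 / 3 + ε * (1 / 3 - γ)) • c ∈ convexHull ℝ ({a, b, c} : Set E3) :=
      mem_convexHull_triple.2 ⟨_, _, _,
        key α (by linarith [abs_nonneg β, abs_nonneg γ]),
        key β (by linarith [abs_nonneg α, abs_nonneg γ]),
        key γ (by linarith [abs_nonneg β, abs_nonneg α]), by linear_combination (-ε) * hs, rfl⟩
    refine hF.right_mem_of_mem_openSegment (hF.subset hf0) hx hz
      ⟨1 / (1 + ε), ε / (1 + ε), by positivity, by positivity, by field_simp, ?_⟩
    have h1 : (1 + ε) ≠ 0 := by positivity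
    match_scalars <;> field_simp <;> ring
  have hmem : ∀ w ∈ V, inner ℝ u w = inner ℝ u a ↔ w ∈ ({a, b, c} : Set E3) := by
    intro w hw
    constructor
    · intro h
      have h1 := hplane w (subset_convexHull ℝ _ hw) h
      apply extremePoints_convexHull_subset (𝕜 := ℝ)
      exact inter_extremePoints_subset_extremePoints_of_subset hF.subset ⟨h1, hV w hw⟩
    · rintro (rfl | rfl | rfl)
      exacts [rfl, hub, huc]
  have hside : ¬ ∃ p ∈ V, ∃ q ∈ V, inner ℝ u p < inner ℝ u a ∧ inner ℝ u a < inner ℝ u q := by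
    rintro ⟨p, hp, q, hq, h1, h2⟩
    have hp' := subset_convexHull ℝ V hp
    have hq' := subset_convexHull ℝ V hq
    set D := inner ℝ u q - inner ℝ u p with hD
    have hD0 : 0 < D := by linarith
    set s := (inner ℝ u q - inner ℝ u a) / D with hs
    set t := (inner ℝ u a - inner ℝ u p) / D with ht
    have hs0 : 0 < s := div_pos (by linarith) hD0
    have ht0 : 0 < t := div_pos (by linarith) hD0
    have hst : s + t = 1 := by rw [hs, ht]; field_simp; rw [hD]; ring
    have hx : inner ℝ u (s • p + t • q) = inner ℝ u a := by
      rw [inner_add_right, inner_smul_right, inner_smul_right, hs, ht]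
      field_simp
      rw [hD]
      ring
    have hxF := hplane _ (convex_convexHull ℝ _ hp' hq' hs0.le ht0.le hst) hx
    have hpF := hF.left_mem_of_mem_openSegment hp' hq' hxF ⟨s, t, hs0, ht0, hst, rfl⟩
    have hp3 : p ∈ ({a, b, c} : Set E3) := by
      apply extremePoints_convexHull_subset (𝕜 := ℝ)
      exact inter_extremePoints_subset_extremePoints_of_subset hF.subset ⟨hpF, hV p hp⟩
    exact h1.ne ((hmem p hp).2 hp3)
  by_cases hup : ∀ w ∈ V, inner ℝ u w ≤ inner ℝ u a
  · exact ⟨u, inner ℝ u a, hu0, hup, hmem⟩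
  · push Not at hup
    obtain ⟨q, hq, hlt⟩ := hup
    refine ⟨-u, -inner ℝ u a, neg_ne_zero.2 hu0, fun w hw => ?_, fun w hw => ?_⟩
    · rw [inner_neg_left, neg_le_neg_iff]
      by_contra hcon
      exact hside ⟨w, hw, q, hq, not_le.1 hcon, hlt⟩
    · rw [inner_neg_left, neg_inj]
      exact hmem w hw

lemma affineIndependent_rotate {a b c : E3} (h : AffineIndependent ℝ ![a, b, c]) :
    AffineIndependent ℝ ![b, c, a] := by
  have h2 := h.comp_embedding (finRotate 3).toEmbedding
  convert! h2 using 1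
  funext i
  fin_cases i <;> rfl

lemma triple_rotate (a b c : E3) : ({b, c, a} : Set E3) = {a, b, c} := by
  ext x
  simp only [Set.mem_insert_iff, Set.mem_singleton_iff]
  tauto

lemma isFaceDim_segment {V : Set E3} {a b : E3} (hab : a ≠ b)
    (h : IsExtreme ℝ (convexHull ℝ V) (segment ℝ a b)) :
    IsFaceDim (convexHull ℝ V) (segment ℝ a b) 1 := by
  refine ⟨⟨a, left_mem_segment ℝ a b⟩, convex_segment a b, h, ?_⟩
  rw [← convexHull_pair, vectorSpan_convexHull, vectorSpan_pair_rev, vsub_eq_sub,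
    finrank_span_singleton (sub_ne_zero.2 hab.symm)]

lemma isFaceDim_edge {V : Set E3} {a b c : E3} (habc : AffineIndependent ℝ ![a, b, c])
    (hF : IsExtreme ℝ (convexHull ℝ V) (convexHull ℝ {a, b, c})) :
    IsFaceDim (convexHull ℝ V) (segment ℝ a b) 1 := by
  have hli := LinearIndependent.pair_iff.1 (linearIndependent_sub habc)
  have hba : b - a ≠ 0 := by
    intro h0
    have := hli 1 0 (by simp [h0])
    simp at this
  have hba2 : 0 < ‖b - a‖ ^ 2 := by positivity
  set e : E3 := ‖b - a‖ ^ 2 • (c - a) - (inner ℝ (c - a) (b - a) : ℝ) • (b - a) with he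
  have he0 : e ≠ 0 := by
    intro h0
    have := (hli (-(inner ℝ (c - a) (b - a) : ℝ)) (‖b - a‖ ^ 2) (by rw [← h0, he]; module)).2
    exact hba2.ne' this
  have h1 : inner ℝ e (b - a) = (0 : ℝ) := by
    rw [he, inner_sub_left, inner_smul_left, inner_smul_left, real_inner_self_eq_norm_sq]
    simp only [conj_trivial]
    ring
  have h2 : 0 < inner ℝ e (c - a) := by
    have h3 : inner ℝ e e = ‖b - a‖ ^ 2 * inner ℝ e (c - a) := by
      conv_lhs => rw [he]
      rw [← he, inner_sub_right, inner_smul_right, inner_smul_right, h1, mul_zero, sub_zero]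
    have h4 : 0 < inner ℝ e e := real_inner_self_pos.2 he0
    rw [h3] at h4
    exact pos_of_mul_pos_right h4 hba2.le
  rw [inner_sub_right] at h1 h2
  have hset : {w ∈ ({a, b, c} : Set E3) | inner ℝ (-e) w = inner ℝ (-e) a} = {a, b} := by
    ext w
    simp only [Set.mem_ofPred_eq, Set.mem_insert_iff, Set.mem_singleton_iff, inner_neg_left,
      neg_inj]
    constructor
    · rintro ⟨rfl | rfl | rfl, h⟩
      · exact Or.inl rfl
      · exact Or.inr rfl
      · linarith
    · rintro (rfl | rfl)
      · exact ⟨Or.inl rfl, rfl⟩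
      · exact ⟨Or.inr (Or.inl rfl), by linarith⟩
  have hext := isExtreme_convexHull_sep (V := {a, b, c}) (u := -e) (r := inner ℝ (-e) a) (by
    rintro w (rfl | rfl | rfl)
    · rfl
    · rw [inner_neg_left, inner_neg_left]; linarith
    · rw [inner_neg_left, inner_neg_left]; linarith)
  rw [hset, convexHull_pair] at hext
  refine isFaceDim_segment (fun h => hba (by rw [h, sub_self])) (hF.trans hext)

lemma mem_edgeLengths_of_triangle {V : Finset E3} {a b c : E3}
    (habc : AffineIndependent ℝ ![a, b, c])
    (hF : IsExtreme ℝ (convexHull ℝ (V : Set E3)) (convexHull ℝ {a, b, c})) :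
    dist a b ∈ edgeLengths V ∧ dist b c ∈ edgeLengths V ∧ dist c a ∈ edgeLengths V := by
  have key : ∀ {a b c : E3}, AffineIndependent ℝ ![a, b, c] →
      IsExtreme ℝ (convexHull ℝ (V : Set E3)) (convexHull ℝ {a, b, c}) →
      dist a b ∈ edgeLengths V := by
    intro a b c h1 h2
    refine ⟨a, b, ?_, isFaceDim_edge h1 h2, rfl⟩
    have := h1.injective.ne (show (0 : Fin 3) ≠ 1 by decide)
    simpa using this
  have h1 := affineIndependent_rotate habc
  have h2 := affineIndependent_rotate h1
  refine ⟨key habc hF, key h1 (by rwa [triple_rotate]), key h2 ?_⟩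
  rwa [triple_rotate, triple_rotate]

lemma real_inner_eq_of_norm_one {p q : E3} (hp : ‖p‖ = 1) (hq : ‖q‖ = 1) :
    inner ℝ p q = 1 - dist p q ^ 2 / 2 := by
  rw [dist_eq_norm, norm_sub_sq_real, hp, hq]
  ring

lemma dist_mem_edgeLengths_of_forall_le {V : Finset E3} (hV : ∀ v ∈ V, ‖v‖ = 1) {p q : E3}
    (hp : p ∈ V) (hq : q ∈ V) (hpq : p ≠ q)
    (hmin : ∀ v ∈ V, ∀ w ∈ V, v ≠ w → dist p q ≤ dist v w) : dist p q ∈ edgeLengths V := by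
  have hd : 0 < dist p q := dist_pos.2 hpq
  have hval : ∀ w ∈ V, inner ℝ (p + q) w = 2 - dist p w ^ 2 / 2 - dist q w ^ 2 / 2 := by
    intro w hw
    rw [inner_add_left, real_inner_eq_of_norm_one (hV p hp) (hV w hw),
      real_inner_eq_of_norm_one (hV q hq) (hV w hw)]
    ring
  have hlt : ∀ w ∈ V, w ≠ p → w ≠ q → inner ℝ (p + q) w < 2 - dist p q ^ 2 / 2 := by
    intro w hw h1 h2
    rw [hval w hw]
    have h3 := hmin p hp w hw h1.symm
    have h4 := hmin q hq w hw h2.symm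
    nlinarith
  have hep : inner ℝ (p + q) p = 2 - dist p q ^ 2 / 2 := by
    rw [hval p hp, dist_self, dist_comm q p]; ring
  have heq : inner ℝ (p + q) q = 2 - dist p q ^ 2 / 2 := by
    rw [hval q hq, dist_self]; ring
  have hext := isExtreme_convexHull_sep (V := V) (u := p + q) (r := 2 - dist p q ^ 2 / 2) (by
    intro w hw
    by_cases h1 : w = p
    · rw [h1, hep]
    by_cases h2 : w = q
    · rw [h2, heq]
    exact (hlt w hw h1 h2).le)
  have hset : {w ∈ (V : Set E3) | inner ℝ (p + q) w = 2 - dist p q ^ 2 / 2} = {p, q} := by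
    ext w
    simp only [Set.mem_ofPred_eq, Set.mem_insert_iff, Set.mem_singleton_iff]
    constructor
    · rintro ⟨hw, h⟩
      by_contra hcon
      push Not at hcon
      exact (hlt w hw hcon.1 hcon.2).ne h
    · rintro (rfl | rfl)
      exacts [⟨hp, hep⟩, ⟨hq, heq⟩]
  rw [hset, convexHull_pair] at hext
  exact ⟨p, q, hpq, isFaceDim_segment hpq hext, rfl⟩

lemma mem_of_isExtreme_segment {V : Set E3} {p q : E3}
    (h : IsExtreme ℝ (convexHull ℝ V) (segment ℝ p q)) : p ∈ V ∧ q ∈ V := by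
  have key : ∀ {p q : E3}, IsExtreme ℝ (convexHull ℝ V) (segment ℝ p q) → p ∈ V := by
    intro p q h
    apply extremePoints_convexHull_subset (𝕜 := ℝ)
    apply h.extremePoints_subset_extremePoints
    refine ⟨left_mem_segment ℝ p q, fun x hx y hy hp => ?_⟩
    obtain ⟨s, hs, rfl⟩ := (segment_eq_image' ℝ p q ▸ hx :
      x ∈ (fun t : ℝ => p + t • (q - p)) '' Set.Icc 0 1)
    obtain ⟨t, ht, rfl⟩ := (segment_eq_image' ℝ p q ▸ hy :
      y ∈ (fun t : ℝ => p + t • (q - p)) '' Set.Icc 0 1)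
    obtain ⟨α, β, hα, hβ, hαβ, h⟩ := hp
    have h1 : (α * s + β * t) • (q - p) = 0 := by
      have h2 : α • p + β • p = p := by rw [← add_smul, hαβ, one_smul]
      have : (α * s + β * t) • (q - p) =
          (α • (p + s • (q - p)) + β • (p + t • (q - p))) - (α • p + β • p) := by module
      rw [this, h2]
      simp only at h
      rw [h, sub_self]
    rcases smul_eq_zero.1 h1 with h2 | h2
    · have h3 : 0 ≤ β * t := mul_nonneg hβ.le ht.1
      have h4 : 0 ≤ α * s := mul_nonneg hα.le hs.1
      have h5 : α * s = 0 := by linarith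
      have h6 : s = 0 := by
        rcases mul_eq_zero.1 h5 with h | h
        · exact absurd h hα.ne'
        · exact h
      simp [h6]
    · simp [h2]
  exact ⟨key h, key (by rwa [segment_symm])⟩

lemma div_le_eta {V : Finset E3} (hV : ∀ v ∈ V, ‖v‖ = 1) {p q : E3}
    (hp : p ∈ V) (hq : q ∈ V) (hpq : p ≠ q)
    (hmin : ∀ v ∈ V, ∀ w ∈ V, v ≠ w → dist p q ≤ dist v w) {b : ℝ} (hb : b ∈ edgeLengths V) :
    b / dist p q ≤ eta V := by
  have hd : 0 < dist p q := dist_pos.2 hpq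
  have hmem := dist_mem_edgeLengths_of_forall_le hV hp hq hpq hmin
  have hlb : ∀ d ∈ edgeLengths V, dist p q ≤ d := by
    rintro d ⟨x, y, hxy, hface, rfl⟩
    obtain ⟨hx, hy⟩ := mem_of_isExtreme_segment hface.2.2.1
    exact hmin x hx y hy hxy
  have hub : BddAbove (edgeLengths V) := by
    refine ⟨2, ?_⟩
    rintro d ⟨x, y, hxy, hface, rfl⟩
    obtain ⟨hx, hy⟩ := mem_of_isExtreme_segment hface.2.2.1
    rw [dist_eq_norm]
    refine (norm_sub_le x y).trans ?_
    rw [hV x hx, hV y hy]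
    norm_num
  have hInf : sInf (edgeLengths V) = dist p q := IsLeast.csInf_eq ⟨hmem, hlb⟩
  rw [eta, hInf]
  gcongr
  exact le_csSup hub hb

lemma not_pairwise_neg_of_orthogonal {g : E3} (hg : g ≠ 0) (d u : Fin 3 → E3)
    (hd : ∀ i, inner ℝ g (d i) = 0) (h0 : ∀ i, inner ℝ (u i) (d i) = 0) :
    ¬ ∀ i j, i ≠ j → inner ℝ (u i) (d j) < 0 := by
  intro hneg
  have hW : ∀ i, d i ∈ (ℝ ∙ g)ᗮ := fun i => by
    rw [Submodule.mem_orthogonal_singleton_iff_inner_right]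
    exact hd i
  have hnli : ¬ LinearIndependent ℝ (fun i => (⟨d i, hW i⟩ : (ℝ ∙ g)ᗮ)) := by
    intro h
    have := h.fintype_card_le_finrank
    rw [finrank_orthogonal_span hg, Fintype.card_fin] at this
    lia
  obtain ⟨c, hc, i, hi⟩ := Fintype.not_linearIndependent_iff.1 hnli
  have hc' : c 0 • d 0 + c 1 • d 1 + c 2 • d 2 = 0 := by
    have := congrArg (Subtype.val) hc
    simpa [Fin.sum_univ_three] using this
  have hrel : ∀ i, c 0 * inner ℝ (u i) (d 0) + c 1 * inner ℝ (u i) (d 1) +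
      c 2 * inner ℝ (u i) (d 2) = 0 := by
    intro i
    have := congrArg (inner ℝ (u i)) hc'
    simpa [inner_add_right, inner_smul_right] using this
  have r0 := hrel 0
  have r1 := hrel 1
  have r2 := hrel 2
  rw [h0] at r0 r1 r2
  have n01 := hneg 0 1 (by decide)
  have n02 := hneg 0 2 (by decide)
  have n10 := hneg 1 0 (by decide)
  have n12 := hneg 1 2 (by decide)
  have n20 := hneg 2 0 (by decide)
  have n21 := hneg 2 1 (by decide)
  have opp : ∀ {x y A B : ℝ}, A < 0 → B < 0 → x * A + y * B = 0 → x * y ≤ 0 ∧ (x = 0 ↔ y = 0) := by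
    intro x y A B hA hB h
    refine ⟨?_, ?_, ?_⟩
    · by_contra hcon
      rcases pos_and_pos_or_neg_and_neg_of_mul_pos (not_le.1 hcon) with ⟨hx, hy⟩ | ⟨hx, hy⟩
      · nlinarith [mul_neg_of_pos_of_neg hx hA, mul_neg_of_pos_of_neg hy hB]
      · nlinarith [mul_pos_of_neg_of_neg hx hA, mul_pos_of_neg_of_neg hy hB]
    · rintro rfl
      simpa [hB.ne] using h
    · rintro rfl
      simpa [hA.ne] using h
  have o12 := opp n01 n02 (by linarith : c 1 * inner ℝ (u 0) (d 1) + c 2 * inner ℝ (u 0) (d 2) = 0)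
  have o02 := opp n10 n12 (by linarith : c 0 * inner ℝ (u 1) (d 0) + c 2 * inner ℝ (u 1) (d 2) = 0)
  have o01 := opp n20 n21 (by linarith : c 0 * inner ℝ (u 2) (d 0) + c 1 * inner ℝ (u 2) (d 1) = 0)
  have h012 : c 0 = 0 := by
    by_contra hne
    have h1 : c 1 ≠ 0 := fun h => hne (o01.2.2 h)
    have h2 : c 2 ≠ 0 := fun h => hne (o02.2.2 h)
    have e1 := lt_of_le_of_ne o12.1 (mul_ne_zero h1 h2)
    have e2 := lt_of_le_of_ne o02.1 (mul_ne_zero hne h2)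
    have e3 := lt_of_le_of_ne o01.1 (mul_ne_zero hne h1)
    have e4 := mul_pos_of_neg_of_neg e1 e2
    have e5 : 0 < (c 2) ^ 2 * (c 0 * c 1) := by linarith
    have e6 : 0 < c 0 * c 1 := pos_of_mul_pos_right e5 (sq_nonneg _)
    linarith
  have h1 := o01.2.1 h012
  have h2 := o02.2.1 h012
  fin_cases i <;> simp_all

/-- Three distinct supporting triangles cannot have a common vertex of intermediate height. -/
lemma not_three_of_mid {V : Set E3} {g : E3} (hg : g ≠ 0) {v : E3} (p q u : Fin 3 → E3)
    (r : Fin 3 → ℝ) (hp : ∀ i, p i ∈ V) (hq : ∀ i, q i ∈ V) (hv : v ∈ V)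
    (hle : ∀ i, ∀ w ∈ V, inner ℝ (u i) w ≤ r i)
    (heq : ∀ i, ∀ w ∈ V, inner ℝ (u i) w = r i ↔ w ∈ ({p i, v, q i} : Set E3))
    (hgp : ∀ i, inner ℝ g v < inner ℝ g (p i)) (hgq : ∀ i, inner ℝ g (q i) < inner ℝ g v)
    (hne : ∀ i j, i ≠ j → ({p i, v, q i} : Set E3) ≠ {p j, v, q j}) : False := by
  have huv : ∀ i, inner ℝ (u i) v = r i := fun i => (heq i v hv).2 (by simp)
  set d : Fin 3 → E3 := fun i => (inner ℝ g v - inner ℝ g (q i) : ℝ) • (p i - v) +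
    (inner ℝ g (p i) - inner ℝ g v : ℝ) • (q i - v) with hd
  have hind : ∀ i j, inner ℝ (u i) (d j) =
      (inner ℝ g v - inner ℝ g (q j)) * (inner ℝ (u i) (p j) - r i) +
      (inner ℝ g (p j) - inner ℝ g v) * (inner ℝ (u i) (q j) - r i) := by
    intro i j
    simp only [hd, inner_add_right, inner_smul_right, inner_sub_right, huv]
  refine not_pairwise_neg_of_orthogonal hg d u ?_ ?_ ?_
  · intro i
    simp only [hd, inner_add_right, inner_smul_right, inner_sub_right]
    ring
  · intro i
    rw [hind, (heq i (p i) (hp i)).2 (by simp), (heq i (q i) (hq i)).2 (by simp)]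
    ring
  · intro i j hij
    rw [hind]
    have h1 := hle i (p j) (hp j)
    have h2 := hle i (q j) (hq j)
    have a1 : 0 < inner ℝ g v - inner ℝ g (q j) := by linarith [hgq j]
    have a2 : 0 < inner ℝ g (p j) - inner ℝ g v := by linarith [hgp j]
    rcases h1.eq_or_lt with e1 | l1
    · rcases h2.eq_or_lt with e2 | l2
      · exfalso
        have m1 := (heq i (p j) (hp j)).1 e1
        have m2 := (heq i (q j) (hq j)).1 e2
        simp only [Set.mem_insert_iff, Set.mem_singleton_iff] at m1 m2
        have k1 : p j = p i := by
          rcases m1 with h | h | h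
          · exact h
          · have := hgp j; rw [h] at this; exact absurd this (lt_irrefl _)
          · have := hgp j; rw [h] at this; exact absurd (this.trans (hgq i)) (lt_irrefl _)
        have k2 : q j = q i := by
          rcases m2 with h | h | h
          · have := hgq j; rw [h] at this; exact absurd (this.trans (hgp i)) (lt_irrefl _)
          · have := hgq j; rw [h] at this; exact absurd this (lt_irrefl _)
          · exact h
        exact hne i j hij (by rw [k1, k2])
      · rw [e1]
        nlinarith
    · nlinarith

lemma exists_generic (V : Finset E3) :
    ∃ g : E3, g ≠ 0 ∧ ∀ v ∈ V, ∀ w ∈ V, v ≠ w → inner ℝ g v ≠ inner ℝ g w := by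
  obtain ⟨f, hf⟩ := Module.exists_dual_forall_apply_ne_zero (K := ℝ)
    (ι := Option {x : V × V // x.1 ≠ x.2})
    (fun x => x.elim (EuclideanSpace.single 0 1 : E3) fun x => (x.1.1 : E3) - x.1.2) (by
      rintro (_ | ⟨⟨v, w⟩, h⟩)
      · simp
      · exact sub_ne_zero.2 fun e => h (Subtype.ext e))
  set g := (InnerProductSpace.toDual ℝ E3).symm (LinearMap.toContinuousLinearMap f) with hg
  have hgf : ∀ x, inner ℝ g x = f x := fun x => by
    rw [hg, InnerProductSpace.toDual_symm_apply]
    rfl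
  refine ⟨g, ?_, ?_⟩
  · intro h0
    have h1 := hf none
    simp only [Option.elim] at h1
    rw [← hgf, h0, inner_zero_left] at h1
    exact h1 rfl
  · intro v hv w hw hvw he
    refine hf (some ⟨(⟨v, hv⟩, ⟨w, hw⟩), by simpa using hvw⟩) ?_
    simp only [Option.elim]
    rw [← hgf, inner_sub_right, he, sub_self]

lemma exists_sorted_triple (g : E3) {a b c : E3} (hab : inner ℝ g a ≠ inner ℝ g b)
    (hac : inner ℝ g a ≠ inner ℝ g c) (hbc : inner ℝ g b ≠ inner ℝ g c) :
    ∃ p v q : E3, ({p, v, q} : Set E3) = {a, b, c} ∧ inner ℝ g v < inner ℝ g p ∧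
      inner ℝ g q < inner ℝ g v := by
  have hset : ∀ {p v q : E3}, (∀ x, x = p ∨ x = v ∨ x = q ↔ x = a ∨ x = b ∨ x = c) →
      ({p, v, q} : Set E3) = {a, b, c} := fun h => by
    ext x
    simpa using h x
  rcases lt_or_gt_of_ne hab with h1 | h1 <;> rcases lt_or_gt_of_ne hac with h2 | h2 <;>
    rcases lt_or_gt_of_ne hbc with h3 | h3
  · exact ⟨c, b, a, hset (by tauto), h3, h1⟩
  · exact ⟨b, c, a, hset (by tauto), h3, h2⟩
  · linarith
  · exact ⟨b, a, c, hset (by tauto), h1, h2⟩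
  · exact ⟨c, a, b, hset (by tauto), h2, h1⟩
  · linarith
  · exact ⟨a, c, b, hset (by tauto), h2, h3⟩
  · exact ⟨a, b, c, hset (by tauto), h1, h3⟩

namespace InscribedTriPoly

variable {m : ℕ} (P : InscribedTriPoly m)

lemma finite_faces : {F : Set E3 | IsFaceDim (convexHull ℝ (P.V : Set E3)) F 2}.Finite := by
  refine ((P.V ×ˢ P.V ×ˢ P.V).finite_toSet.image
    (fun x => convexHull ℝ ({x.1, x.2.1, x.2.2} : Set E3))).subset ?_
  intro F hF
  obtain ⟨a, b, c, ha, hb, hc, -, rfl⟩ := P.faces_triangles F hF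
  exact ⟨(a, b, c), by simp [ha, hb, hc], rfl⟩

/-- The faces of the polytope, as a finite set. -/
def faces : Finset (Set E3) := P.finite_faces.toFinset

lemma mem_faces {F : Set E3} : F ∈ P.faces ↔ IsFaceDim (convexHull ℝ (P.V : Set E3)) F 2 := by
  simp [faces]

lemma card_faces_eq : P.faces.card = m := by
  rw [faces, ← Set.ncard_eq_toFinset_card _ P.finite_faces, P.card_faces]

lemma exists_supporting_of_mem_faces {F : Set E3} (hF : F ∈ P.faces) :
    ∃ (a b c u : E3) (r : ℝ), a ∈ P.V ∧ b ∈ P.V ∧ c ∈ P.V ∧ AffineIndependent ℝ ![a, b, c] ∧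
      F = convexHull ℝ {a, b, c} ∧ u ≠ 0 ∧ (∀ w ∈ P.V, inner ℝ u w ≤ r) ∧
      ∀ w ∈ P.V, inner ℝ u w = r ↔ w ∈ ({a, b, c} : Set E3) := by
  rw [mem_faces] at hF
  obtain ⟨a, b, c, ha, hb, hc, habc, rfl⟩ := P.faces_triangles F hF
  obtain ⟨u, r, hu, h1, h2⟩ := exists_supporting (V := P.V) P.is_vertex habc hF.2.2.1
  exact ⟨a, b, c, u, r, ha, hb, hc, habc, rfl, hu, h1, h2⟩

lemma exists_sorted_of_mem_faces {g : E3}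
    (hg : ∀ v ∈ P.V, ∀ w ∈ P.V, v ≠ w → inner ℝ g v ≠ inner ℝ g w) {F : Set E3}
    (hF : F ∈ P.faces) :
    ∃ (p v q u : E3) (r : ℝ), p ∈ P.V ∧ v ∈ P.V ∧ q ∈ P.V ∧ F = convexHull ℝ {p, v, q} ∧
      inner ℝ g v < inner ℝ g p ∧ inner ℝ g q < inner ℝ g v ∧ (∀ w ∈ P.V, inner ℝ u w ≤ r) ∧
      ∀ w ∈ P.V, inner ℝ u w = r ↔ w ∈ ({p, v, q} : Set E3) := by
  obtain ⟨a, b, c, u, r, ha, hb, hc, habc, rfl, -, h1, h2⟩ := P.exists_supporting_of_mem_faces hF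
  have hinj := habc.injective
  have hab : a ≠ b := by simpa using hinj.ne (show (0 : Fin 3) ≠ 1 by decide)
  have hac : a ≠ c := by simpa using hinj.ne (show (0 : Fin 3) ≠ 2 by decide)
  have hbc : b ≠ c := by simpa using hinj.ne (show (1 : Fin 3) ≠ 2 by decide)
  obtain ⟨p, v, q, hset, hvp, hqv⟩ := exists_sorted_triple g (hg a ha b hb hab) (hg a ha c hc hac)
    (hg b hb c hc hbc)
  have hsub : ∀ x ∈ ({p, v, q} : Set E3), x ∈ P.V := by
    rw [hset]
    rintro x (rfl | rfl | rfl) <;> assumption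
  refine ⟨p, v, q, u, r, hsub p (by simp), hsub v (by simp), hsub q (by simp), by rw [hset],
    hvp, hqv, h1, by rwa [hset]⟩

lemma nonempty_V : P.V.Nonempty := by
  by_contra h
  rw [Finset.not_nonempty_iff_eq_empty] at h
  have := P.full_dim
  rw [h] at this
  simp at this

lemma exists_ne : ∃ v ∈ P.V, ∃ w ∈ P.V, v ≠ w := by
  obtain ⟨v, hv⟩ := P.nonempty_V
  by_contra hcon
  push Not at hcon
  have h : (P.V : Set E3) = {v} := by
    ext w
    exact ⟨fun hw => (hcon v hv w hw).symm, by rintro rfl; exact hv⟩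
  have := P.full_dim
  rw [h] at this
  have h2 : (v + EuclideanSpace.single 0 1 : E3) ∈ affineSpan ℝ ({v} : Set E3) := by
    rw [this]; trivial
  rw [AffineSubspace.mem_affineSpan_singleton] at h2
  simp at h2

/-- A simplicial polytope with `n` vertices has at most `2 n - 4` faces. -/
lemma card_faces_add_four_le : m + 4 ≤ 2 * P.V.card := by
  classical
  obtain ⟨g, hg0, hg⟩ := exists_generic P.V
  choose! p mid q u r hp hmid hq hF hgp hgq hle heq using
    fun F (hF : F ∈ P.faces) => P.exists_sorted_of_mem_faces hg hF
  obtain ⟨t, ht, htmax⟩ := P.V.exists_max_image (fun v => inner ℝ g v) P.nonempty_V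
  obtain ⟨s, hs, hsmin⟩ := P.V.exists_min_image (fun v => inner ℝ g v) P.nonempty_V
  have hts : t ≠ s := by
    rintro rfl
    obtain ⟨v, hv, w, hw, hvw⟩ := P.exists_ne
    exact hg v hv w hw hvw (le_antisymm ((htmax v hv).trans (hsmin w hw))
      ((htmax w hw).trans (hsmin v hv)))
  have hmaps : ∀ F ∈ P.faces, mid F ∈ (P.V.erase t).erase s := by
    intro F h
    refine Finset.mem_erase.2 ⟨?_, Finset.mem_erase.2 ⟨?_, hmid F h⟩⟩
    · intro he
      have h1 := hgq F h
      rw [he] at h1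
      exact (hsmin _ (hq F h)).not_gt h1
    · intro he
      have h1 := hgp F h
      rw [he] at h1
      exact (htmax _ (hp F h)).not_gt h1
  have hcard : P.faces.card ≤ 2 * ((P.V.erase t).erase s).card := by
    refine Finset.card_le_mul_card_image_of_maps_to hmaps 2 fun v hv => ?_
    by_contra hcon
    obtain ⟨F₀, h0, F₁, h1, F₂, h2, h01, h02, h12⟩ := Finset.two_lt_card.1 (not_le.1 hcon)
    have hmem : ∀ i : Fin 3, ![F₀, F₁, F₂] i ∈ P.faces ∧ mid (![F₀, F₁, F₂] i) = v := by
      intro i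
      fin_cases i
      exacts [Finset.mem_filter.1 h0, Finset.mem_filter.1 h1, Finset.mem_filter.1 h2]
    have hinj : ∀ i j : Fin 3, i ≠ j → ![F₀, F₁, F₂] i ≠ ![F₀, F₁, F₂] j := by
      intro i j hij
      fin_cases i <;> fin_cases j <;> first
        | exact absurd rfl hij
        | exact h01
        | exact h02
        | exact h12
        | exact h01.symm
        | exact h02.symm
        | exact h12.symm
    set G := ![F₀, F₁, F₂] with hG
    refine not_three_of_mid (V := P.V) hg0 (v := v) (fun i => p (G i)) (fun i => q (G i))
      (fun i => u (G i)) (fun i => r (G i)) (fun i => hp _ (hmem i).1) (fun i => hq _ (hmem i).1)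
      ?_ (fun i => hle _ (hmem i).1) ?_ ?_ ?_ ?_
    · exact Finset.mem_of_mem_erase (Finset.mem_of_mem_erase hv)
    · intro i w hw
      have := heq _ (hmem i).1 w hw
      rwa [(hmem i).2] at this
    · intro i
      have := hgp _ (hmem i).1
      rwa [(hmem i).2] at this
    · intro i
      have := hgq _ (hmem i).1
      rwa [(hmem i).2] at this
    · intro i j hij he
      apply hinj i j hij
      rw [hF _ (hmem i).1, hF _ (hmem j).1, (hmem i).2, (hmem j).2]
      exact congrArg _ he
  rw [Finset.card_erase_of_mem (Finset.mem_erase.2 ⟨hts.symm, hs⟩), Finset.card_erase_of_mem ht,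
    P.card_faces_eq] at hcard
  have : 2 ≤ P.V.card := Finset.one_lt_card.2 ⟨t, ht, s, hs, hts⟩
  lia

end InscribedTriPoly

lemma integral_cos_le_cos_le {α : ℝ} (hα0 : 0 ≤ α) (hα : α ≤ π) (ψ : ℝ) :
    ∫ θ in (-π)..π, {t : ℝ | Real.cos α ≤ Real.cos t}.indicator 1 (θ - ψ) ≤ 2 * α := by
  have hπ := Real.pi_pos
  set I : ℝ → ℝ := {t : ℝ | Real.cos α ≤ Real.cos t}.indicator 1 with hI
  have hmeas : MeasurableSet {t : ℝ | Real.cos α ≤ Real.cos t} :=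
    measurableSet_le (by fun_prop) (by fun_prop)
  have hper : Function.Periodic I (2 * π) := by
    intro t
    simp only [hI, Set.indicator, Set.mem_ofPred_eq, Real.cos_add_two_pi]
    rfl
  have h1 : ∫ θ in (-π)..π, I (θ - ψ) = ∫ θ in (-π)..π, I θ := by
    rw [intervalIntegral.integral_comp_sub_right]
    have := hper.intervalIntegral_add_eq (-π - ψ) (-π)
    rw [show -π - ψ + 2 * π = π - ψ by ring, show -π + 2 * π = π by ring] at this
    exact this
  have hIint : ∀ a b, IntervalIntegrable I MeasureTheory.volume a b := by
    intro a b
    refine (intervalIntegrable_const (c := (1 : ℝ))).mono_fun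
      (measurable_one.indicator hmeas).aestronglyMeasurable
      (MeasureTheory.ae_of_all _ fun t => ?_)
    simp only [hI, Set.indicator]
    split_ifs <;> simp
  rw [h1]
  have h2 : ∫ θ in (-π)..π, I θ = (∫ θ in (-π)..(-α), I θ) + (∫ θ in (-α)..α, I θ) +
      ∫ θ in α..π, I θ := by
    rw [intervalIntegral.integral_add_adjacent_intervals (hIint _ _) (hIint _ _),
      intervalIntegral.integral_add_adjacent_intervals (hIint _ _) (hIint _ _)]
  have hzero : ∀ t, α < |t| → |t| ≤ π → I t = 0 := by
    intro t ht1 ht2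
    simp only [hI, Set.indicator, Set.mem_ofPred_eq]
    rw [if_neg]
    rw [not_le, ← Real.cos_abs t]
    exact Real.cos_lt_cos_of_nonneg_of_le_pi hα0 ht2 ht1
  have h3 : ∫ θ in (-π)..(-α), I θ = 0 := by
    rw [intervalIntegral.integral_of_le (by linarith), MeasureTheory.integral_Ioc_eq_integral_Ioo]
    refine MeasureTheory.setIntegral_eq_zero_of_forall_eq_zero fun t ht => ?_
    refine hzero t ?_ ?_
    · rw [abs_of_neg (by linarith [ht.2])]; linarith [ht.2]
    · rw [abs_of_neg (by linarith [ht.2])]; linarith [ht.1]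
  have h4 : ∫ θ in α..π, I θ = 0 := by
    rw [intervalIntegral.integral_of_le hα]
    refine MeasureTheory.setIntegral_eq_zero_of_forall_eq_zero fun t ht => ?_
    refine hzero t ?_ ?_
    · rw [abs_of_pos (by linarith [ht.1])]; exact ht.1
    · rw [abs_of_pos (by linarith [ht.1])]; exact ht.2
  have h5 : ∫ θ in (-α)..α, I θ ≤ ∫ _θ in (-α)..α, (1 : ℝ) := by
    refine intervalIntegral.integral_mono_on (by linarith) (hIint _ _) (by simp) fun t _ => ?_
    simp only [hI, Set.indicator]
    split_ifs <;> simp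
  simp only [intervalIntegral.integral_const, smul_eq_mul] at h5
  linarith

/-- Five arcs of the circle of angular length less than `2π/5` do not cover the circle. -/
lemma exists_forall_cos_lt {ι : Type*} {s : Finset ι} (hs : s.card ≤ 5) (ψ y : ι → ℝ)
    (hy : ∀ i ∈ s, Real.cos (π / 5) < y i) : ∃ θ, ∀ i ∈ s, Real.cos (θ - ψ i) < y i := by
  by_contra! hcon
  have hπ := Real.pi_pos
  have hne : s.Nonempty := by
    obtain ⟨i, hi, -⟩ := hcon 0
    exact ⟨i, hi⟩
  obtain ⟨i₀, hi₀, hmin⟩ := s.exists_min_image y hne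
  have hy1 : y i₀ ≤ 1 := by
    obtain ⟨i, hi, h⟩ := hcon 0
    exact (hmin i hi).trans (h.trans (Real.cos_le_one _))
  have h36 : 0 < Real.cos (π / 5) := Real.cos_pos_of_mem_Ioo ⟨by linarith, by linarith⟩
  have hy0 := hy i₀ hi₀
  set α := Real.arccos (y i₀) with hα
  have hcos : Real.cos α = y i₀ := Real.cos_arccos (by linarith) hy1
  have hα0 : 0 ≤ α := Real.arccos_nonneg _
  have hα5 : α < π / 5 := by
    rw [hα, ← Real.arccos_cos (x := π / 5) (by linarith) (by linarith)]
    exact Real.arccos_lt_arccos (by linarith) hy0 hy1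
  set I : ℝ → ℝ := {t : ℝ | Real.cos α ≤ Real.cos t}.indicator 1 with hI
  have hmeas : MeasurableSet {t : ℝ | Real.cos α ≤ Real.cos t} :=
    measurableSet_le (by fun_prop) (by fun_prop)
  have hI0 : ∀ t, 0 ≤ I t := fun t => Set.indicator_nonneg (fun _ _ => zero_le_one) t
  have hIint : ∀ i, IntervalIntegrable (fun θ => I (θ - ψ i)) MeasureTheory.volume (-π) π := by
    intro i
    refine (intervalIntegrable_const (c := (1 : ℝ))).mono_fun
      ((measurable_one.indicator hmeas).comp (by fun_prop)).aestronglyMeasurable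
      (MeasureTheory.ae_of_all _ fun t => ?_)
    simp only [hI, Set.indicator]
    split_ifs <;> simp
  have h1 : ∫ _θ in (-π)..π, (1 : ℝ) ≤ ∫ θ in (-π)..π, ∑ i ∈ s, I (θ - ψ i) := by
    refine intervalIntegral.integral_mono_on (by linarith) (by simp) ?_ fun θ _ => ?_
    · have h := IntervalIntegrable.sum s (f := fun i θ => I (θ - ψ i)) fun i _ => hIint i
      have h2 : (∑ i ∈ s, fun θ => I (θ - ψ i)) = fun θ => ∑ i ∈ s, I (θ - ψ i) := by
        funext θ
        simp
      rwa [h2] at h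
    · obtain ⟨i, hi, h⟩ := hcon θ
      have h2 : I (θ - ψ i) = 1 := by
        simp only [hI, Set.indicator, Set.mem_ofPred_eq]
        rw [if_pos (by rw [hcos]; exact (hmin i hi).trans h)]
        rfl
      rw [← h2]
      exact Finset.single_le_sum (f := fun i => I (θ - ψ i)) (fun j _ => hI0 _) hi
  rw [intervalIntegral.integral_finsetSum fun i _ => hIint i] at h1
  have h2 : ∑ i ∈ s, ∫ θ in (-π)..π, I (θ - ψ i) ≤ ∑ _i ∈ s, 2 * α :=
    Finset.sum_le_sum fun i _ => integral_cos_le_cos_le hα0 (by linarith) (ψ i)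
  simp only [intervalIntegral.integral_const, smul_eq_mul, Finset.sum_const, nsmul_eq_mul] at h1 h2
  have h3 : (s.card : ℝ) ≤ 5 := by exact_mod_cast hs
  nlinarith

lemma one_add_cos_two_pi_div_five : (1 + Real.cos (2 * π / 5)) / 2 = Real.cos (π / 5) ^ 2 := by
  rw [Real.cos_sq, show 2 * (π / 5) = 2 * π / 5 by ring]
  ring

/-- A planar sector of angle less than `2π/5` lies in a short arc around its bisector. -/
lemma exists_bisector {p q : E3} (hpq : Real.cos (2 * π / 5) * (‖p‖ * ‖q‖) < inner ℝ p q) :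
    ∃ (m : E3) (y : ℝ), ‖m‖ = 1 ∧ (∀ v : E3, inner ℝ v p = 0 → inner ℝ v q = 0 → inner ℝ v m = 0) ∧
      Real.cos (π / 5) < y ∧ ∀ β γ : ℝ, 0 ≤ β → 0 ≤ γ → ‖β • p + γ • q‖ = 1 →
        y ≤ inner ℝ (β • p + γ • q) m := by
  have hπ := Real.pi_pos
  have hk0 : 0 < Real.cos (2 * π / 5) := Real.cos_pos_of_mem_Ioo ⟨by linarith, by linarith⟩
  have h36 : 0 < Real.cos (π / 5) := Real.cos_pos_of_mem_Ioo ⟨by linarith, by linarith⟩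
  have hp : p ≠ 0 := by rintro rfl; simp at hpq
  have hq : q ≠ 0 := by rintro rfl; simp at hpq
  have hp0 : 0 < ‖p‖ := norm_pos_iff.2 hp
  have hq0 : 0 < ‖q‖ := norm_pos_iff.2 hq
  set c := inner ℝ p q / (‖p‖ * ‖q‖) with hc
  have hck : Real.cos (2 * π / 5) < c := by rwa [hc, lt_div_iff₀ (by positivity)]
  have hc1 : c ≤ 1 := by
    rw [hc, div_le_one (by positivity)]
    exact real_inner_le_norm p q
  have hcin : inner ℝ p q = c * (‖p‖ * ‖q‖) := by rw [hc]; field_simp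
  set M : E3 := (1 / ‖p‖) • p + (1 / ‖q‖) • q with hM
  have hinp : inner ℝ p M = ‖p‖ * (1 + c) := by
    rw [hM, inner_add_right, inner_smul_right, inner_smul_right, hcin,
      real_inner_self_eq_norm_sq]
    field_simp
  have hinq : inner ℝ q M = ‖q‖ * (1 + c) := by
    rw [hM, inner_add_right, inner_smul_right, inner_smul_right, real_inner_comm, hcin,
      real_inner_self_eq_norm_sq]
    field_simp
    ring
  have hMM : ‖M‖ ^ 2 = 2 * (1 + c) := by
    rw [← real_inner_self_eq_norm_sq]
    conv_lhs => rw [hM]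
    rw [← hM, inner_add_left, inner_smul_left, inner_smul_left, hinp, hinq]
    simp only [conj_trivial]
    field_simp
    ring
  have hM0 : 0 < ‖M‖ := by
    rcases (norm_nonneg M).eq_or_lt with h | h
    · rw [← h] at hMM; nlinarith
    · exact h
  refine ⟨(1 / ‖M‖) • M, ‖M‖ / 2, ?_, ?_, ?_, ?_⟩
  · rw [norm_smul, norm_div, norm_one, norm_norm]; field_simp
  · intro v hvp hvq
    rw [hM]
    simp only [inner_smul_right, inner_add_right, hvp, hvq]
    simp
  · refine lt_of_pow_lt_pow_left₀ 2 (by positivity) ?_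
    rw [← one_add_cos_two_pi_div_five, div_pow, hMM]
    linarith
  · intro β γ hβ hγ h1
    have h2 : ‖β • p + γ • q‖ ^ 2 = (β * ‖p‖) ^ 2 + 2 * c * (β * ‖p‖) * (γ * ‖q‖) +
        (γ * ‖q‖) ^ 2 := by
      rw [norm_add_sq_real, inner_smul_left, inner_smul_right, hcin, norm_smul, norm_smul,
        Real.norm_of_nonneg hβ, Real.norm_of_nonneg hγ]
      simp only [conj_trivial]
      ring
    rw [h1] at h2
    have hB : 0 ≤ β * ‖p‖ := by positivity
    have hG : 0 ≤ γ * ‖q‖ := by positivity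
    have h3 : 1 ≤ β * ‖p‖ + γ * ‖q‖ := by
      have := mul_nonneg hB hG
      nlinarith
    rw [inner_smul_right, inner_add_left, inner_smul_left, inner_smul_left, hinp, hinq]
    simp only [conj_trivial]
    have h4 : 1 / ‖M‖ * (β * (‖p‖ * (1 + c)) + γ * (‖q‖ * (1 + c))) =
        (β * ‖p‖ + γ * ‖q‖) * (‖M‖ / 2) := by
      have : 1 + c = ‖M‖ ^ 2 / 2 := by rw [hMM]; ring
      rw [this]
      field_simp
    rw [h4]
    nlinarith

/-- If at most five sectors cover the plane orthogonal to `v`, one of them has angle at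
least `2π/5`. -/
lemma exists_wide_sector {ι : Type*} {s : Finset ι} (hs : s.card ≤ 5) {v : E3} (hv : ‖v‖ = 1)
    (p q : ι → E3) (hp : ∀ i ∈ s, inner ℝ v (p i) = 0) (hq : ∀ i ∈ s, inner ℝ v (q i) = 0)
    (hcov : ∀ φ : E3, ‖φ‖ = 1 → inner ℝ v φ = 0 →
      ∃ i ∈ s, ∃ β γ : ℝ, 0 ≤ β ∧ 0 ≤ γ ∧ φ = β • p i + γ • q i) :
    ∃ i ∈ s, inner ℝ (p i) (q i) ≤ Real.cos (2 * π / 5) * (‖p i‖ * ‖q i‖) := by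
  by_contra! hcon
  choose! m y hm1 hmv hy hbis using fun i hi => exists_bisector (hcon i hi)
  obtain ⟨b, hb⟩ := Orthonormal.exists_orthonormalBasis_extension_of_card_eq (𝕜 := ℝ) (E := E3)
    (ι := Fin 3) (by simp) (v := fun _ => v) (s := {2})
    (by rw [orthonormal_iff_ite]; rintro ⟨x, rfl⟩ ⟨y, rfl⟩; simp [hv])
  have hb2 : b 2 = v := hb 2 rfl
  have hb' := orthonormal_iff_ite.1 b.orthonormal
  choose κ ψ hκ0 hκ2 hκc hκs using fun i => exists_polar (inner ℝ (m i) (b 0)) (inner ℝ (m i) (b 1))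
  have hκ1 : ∀ i ∈ s, κ i = 1 := by
    intro i hi
    have h1 := b.sum_sq_inner_right (m i)
    rw [Fin.sum_univ_three, hm1 i hi, hb2, hmv i hi v (hp i hi) (hq i hi),
      real_inner_comm, real_inner_comm (m i) (b 1)] at h1
    have h2 := hκ2 i
    have h3 := hκ0 i
    nlinarith
  obtain ⟨θ, hθ⟩ := exists_forall_cos_lt hs ψ y hy
  set φ : E3 := Real.cos θ • b 0 + Real.sin θ • b 1 with hφ
  have hvφ : inner ℝ v φ = 0 := by
    rw [hφ, inner_add_right, inner_smul_right, inner_smul_right, ← hb2, hb', hb']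
    simp
  have hφ1 : ‖φ‖ = 1 := by
    have h1 := b.sum_sq_inner_right φ
    rw [Fin.sum_univ_three, hb2, hvφ, hφ] at h1
    simp only [inner_add_right, inner_smul_right, hb'] at h1
    rw [← hφ] at h1
    simp at h1
    rw [← sq_eq_sq₀ (norm_nonneg _) zero_le_one, ← h1]
    simp
  obtain ⟨i, hi, β, γ, hβ, hγ, he⟩ := hcov φ hφ1 hvφ
  have h1 := hbis i hi β γ hβ hγ (by rw [← he]; exact hφ1)
  rw [← he] at h1
  have h2 := hθ i hi
  have h3 : inner ℝ φ (m i) = Real.cos (θ - ψ i) := by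
    rw [hφ, inner_add_left, inner_smul_left, inner_smul_left, real_inner_comm,
      real_inner_comm (m i) (b 1), hκc, hκs, hκ1 i hi, Real.cos_sub]
    simp
  rw [h3] at h1
  linarith

namespace InscribedTriPoly

variable {m : ℕ} (P : InscribedTriPoly m)

lemma mem_of_mem_convexHull {S : Set E3} (hS : S ⊆ P.V) {w : E3} (hw : w ∈ P.V)
    (hwS : w ∈ convexHull ℝ S) : w ∈ S :=
  extremePoints_convexHull_subset (inter_extremePoints_subset_extremePoints_of_subset
    (convexHull_mono hS) ⟨hwS, P.is_vertex w hw⟩)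

open Classical in
lemma exists_low_degree : ∃ v ∈ P.V, (P.faces.filter (v ∈ ·)).card ≤ 5 := by
  by_contra! hcon
  have h1 : P.V.card * 6 ≤ ∑ v ∈ P.V, (P.faces.filter (v ∈ ·)).card := by
    rw [← smul_eq_mul]
    exact Finset.card_nsmul_le_sum _ _ _ fun v hv => hcon v hv
  have h2 : ∑ v ∈ P.V, (P.faces.filter (v ∈ ·)).card =
      ∑ F ∈ P.faces, (P.V.filter (· ∈ F)).card :=
    Finset.sum_card_bipartiteAbove_eq_sum_card_bipartiteBelow (fun (v : E3) (F : Set E3) => v ∈ F)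
  have h3 : ∑ F ∈ P.faces, (P.V.filter (· ∈ F)).card ≤ P.faces.card * 3 := by
    rw [← smul_eq_mul]
    refine Finset.sum_le_card_nsmul _ _ _ fun F hF => ?_
    obtain ⟨a, b, c, -, -, ha, hb, hc, -, rfl, -⟩ := P.exists_supporting_of_mem_faces hF
    refine (Finset.card_le_card (t := {a, b, c}) fun w hw => ?_).trans Finset.card_le_three
    rw [Finset.mem_filter] at hw
    have := P.mem_of_mem_convexHull (S := {a, b, c})
      (by rintro x (rfl | rfl | rfl) <;> assumption) hw.1 hw.2
    simpa using this
  rw [P.card_faces_eq] at h3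
  have := P.card_faces_add_four_le
  lia

/-- The cone with apex `0` over `F`, truncated at `F`. -/
def trunc (F : Set E3) : Set E3 := (fun x : ℝ × E3 => x.1 • x.2) '' (Set.Icc 0 1 ×ˢ F)

lemma isClosed_trunc {F : Set E3} (hF : F ∈ P.faces) : IsClosed (trunc F) := by
  obtain ⟨a, b, c, -, -, -, -, -, -, rfl, -⟩ := P.exists_supporting_of_mem_faces hF
  have : IsCompact (convexHull ℝ ({a, b, c} : Set E3)) :=
    (Set.toFinite {a, b, c}).isCompact_convexHull ℝ
  exact ((isCompact_Icc.prod this).image (by fun_prop)).isClosed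

lemma mem_faces_of_span_eq_top {u : E3} {r : ℝ} (hu : u ≠ 0) (h : ∀ w ∈ P.V, inner ℝ u w ≤ r)
    (hne : {w ∈ (P.V : Set E3) | inner ℝ u w = r}.Nonempty)
    (hs : Submodule.span ℝ {w ∈ (P.V : Set E3) | inner ℝ u w = r} = ⊤) :
    convexHull ℝ {w ∈ (P.V : Set E3) | inner ℝ u w = r} ∈ P.faces := by
  rw [mem_faces]
  refine isFaceDim_convexHull_sep h hne ?_
  set S := {w ∈ (P.V : Set E3) | inner ℝ u w = r} with hS
  apply le_antisymm (finrank_vectorSpan_le_two hu (r := r) fun w hw => hw.2)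
  obtain ⟨w0, hw0⟩ := hne
  have h1 : (⊤ : Submodule ℝ E3) ≤ vectorSpan ℝ S ⊔ Submodule.span ℝ {w0} := by
    rw [← hs, Submodule.span_le]
    intro w hw
    rw [show w = (w - w0) + w0 by abel]
    exact Submodule.add_mem_sup (vsub_mem_vectorSpan ℝ hw hw0)
      (Submodule.mem_span_singleton_self w0)
  have h2 := Submodule.finrank_mono h1
  have h3 := Submodule.finrank_add_le_finrank_add_finrank (vectorSpan ℝ S) (Submodule.span ℝ {w0})
  have h4 := finrank_span_le_card (R := ℝ) ({w0} : Set E3)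
  simp only [finrank_top, finrank_euclideanSpace, Fintype.card_fin, Set.toFinset_singleton,
    Finset.card_singleton] at h2 h4
  exact Nat.le_of_add_le_add_right (b := 1) (h2.trans (h3.trans (Nat.add_le_add_left h4 _)))

lemma isCompact_hull : IsCompact (convexHull ℝ (P.V : Set E3)) :=
  P.V.finite_toSet.isCompact_convexHull ℝ

/-- A point of the interior in general position lies in the cone over some face. -/
lemma exists_mem_trunc_of_generic {x : E3} (hx0 : x ≠ 0)
    (h0 : (0 : E3) ∈ interior (convexHull ℝ (P.V : Set E3)))
    (hx : x ∈ convexHull ℝ (P.V : Set E3))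
    (hgen : ∀ S ⊆ (P.V : Set E3), x ∈ Submodule.span ℝ S → Submodule.span ℝ S = ⊤) :
    ∃ F ∈ P.faces, x ∈ trunc F := by
  set H := convexHull ℝ (P.V : Set E3) with hH
  have hcpt : IsCompact H := P.isCompact_hull
  obtain ⟨R, hR⟩ := hcpt.isBounded.exists_norm_le
  have hxn : 0 < ‖x‖ := norm_pos_iff.2 hx0
  have hKc : IsCompact {s : ℝ | 0 ≤ s ∧ s • x ∈ H} := by
    refine (isCompact_Icc (a := 0) (b := R / ‖x‖)).of_isClosed_subset ?_ ?_
    · exact (isClosed_Ici (a := (0 : ℝ))).inter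
        (hcpt.isClosed.preimage (f := fun s : ℝ => s • x) (by fun_prop))
    · rintro s ⟨hs, hsx⟩
      have := hR _ hsx
      rw [norm_smul, Real.norm_of_nonneg hs] at this
      exact ⟨hs, (le_div_iff₀ hxn).2 this⟩
  have h1K : (1 : ℝ) ∈ {s : ℝ | 0 ≤ s ∧ s • x ∈ H} := ⟨zero_le_one, by simpa using hx⟩
  obtain ⟨s, ⟨hs0, hsH⟩, hmax⟩ := hKc.exists_isMaxOn ⟨1, h1K⟩ continuousOn_id
  have hs1 : 1 ≤ s := hmax h1K
  have hnot : s • x ∉ interior H := by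
    intro hInt
    have hcont : Continuous fun t : ℝ => t • x := by fun_prop
    have hnhds : ∀ᶠ t in nhds s, t • x ∈ interior H :=
      hcont.continuousAt.eventually (isOpen_interior.mem_nhds hInt)
    obtain ⟨t, ht, hts⟩ := (hnhds.filter_mono nhdsWithin_le_nhds |>.and
      (self_mem_nhdsWithin (s := Set.Ioi s))).exists
    have := hmax (show t ∈ {s : ℝ | 0 ≤ s ∧ s • x ∈ H} from
      ⟨hs0.trans (le_of_lt hts), interior_subset ht⟩)
    exact absurd this (not_le.2 hts)
  obtain ⟨f, hf⟩ := geometric_hahn_banach_open_point (convex_convexHull ℝ _).interior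
    isOpen_interior hnot
  set u := (InnerProductSpace.toDual ℝ E3).symm f with hu
  have huf : ∀ z, inner ℝ u z = f z := fun z => InnerProductSpace.toDual_symm_apply
  have hr : 0 < f (s • x) := by simpa using hf 0 h0
  have hle : ∀ z ∈ H, f z ≤ f (s • x) := by
    intro z hz
    have hcl : z ∈ closure (interior H) := by
      rw [(convex_convexHull ℝ _).closure_interior_eq_closure_of_nonempty_interior ⟨0, h0⟩]
      exact subset_closure hz
    exact closure_minimal (fun y hy => (hf y hy).le)
      (isClosed_le f.continuous continuous_const) hcl
  have hu0 : u ≠ 0 := by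
    intro h
    have := huf (s • x)
    rw [h, inner_zero_left] at this
    exact hr.ne this
  have hleV : ∀ w ∈ P.V, inner ℝ u w ≤ f (s • x) := fun w hw => by
    rw [huf]
    exact hle w (subset_convexHull ℝ _ hw)
  rcases mem_convexHull_or_inner_lt (V := (P.V : Set E3)) hleV hsH with ⟨-, hmem⟩ | hlt
  swap
  · exact absurd (huf _) hlt.ne
  set S := {w ∈ (P.V : Set E3) | inner ℝ u w = f (s • x)} with hS
  have hspan : s • x ∈ Submodule.span ℝ S :=
    convexHull_min Submodule.subset_span (Submodule.span ℝ S).convex hmem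
  have hspos : 0 < s := by linarith
  have hxS : x ∈ Submodule.span ℝ S := (Submodule.smul_mem_iff _ hspos.ne').1 hspan
  refine ⟨convexHull ℝ S, P.mem_faces_of_span_eq_top hu0 hleV
    (convexHull_nonempty_iff.1 ⟨_, hmem⟩) (hgen S (Set.sep_subset _ _) hxS), ⟨(s⁻¹, s • x),
    ⟨⟨inv_nonneg.2 hs0, inv_le_one_of_one_le₀ hs1⟩, hmem⟩, ?_⟩⟩
  simp [smul_smul, hspos.ne']

open MeasureTheory in
lemma dense_generic : Dense {x : E3 | x ≠ 0 ∧
    ∀ S ⊆ (P.V : Set E3), x ∈ Submodule.span ℝ S → Submodule.span ℝ S = ⊤} := by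
  refine Measure.dense_of_ae (μ := volume) ?_
  refine (Measure.ae_ne volume 0).and ?_
  have hfin : {S : Set E3 | S ⊆ (P.V : Set E3)}.Finite := P.V.finite_toSet.finite_subsets
  refine (ae_ball_iff hfin.countable).2 fun S _ => ?_
  by_cases hS : Submodule.span ℝ S = ⊤
  · simp [hS]
  · have := Measure.addHaar_submodule (volume : Measure E3) _ hS
    filter_upwards [measure_eq_zero_iff_ae_notMem.1 this] with x hx h
    exact absurd h hx

lemma interior_subset_iUnion_trunc
    (h0 : (0 : E3) ∈ interior (convexHull ℝ (P.V : Set E3))) :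
    interior (convexHull ℝ (P.V : Set E3)) ⊆ ⋃ F ∈ P.faces, trunc F := by
  have hcl : IsClosed (⋃ F ∈ P.faces, trunc F) :=
    P.faces.finite_toSet.isClosed_biUnion fun F hF => P.isClosed_trunc hF
  refine (P.dense_generic.open_subset_closure_inter isOpen_interior).trans
    (closure_minimal ?_ hcl)
  rintro x ⟨hxi, hx0, hxg⟩
  obtain ⟨F, hF, hx⟩ := P.exists_mem_trunc_of_generic hx0 h0 (interior_subset hxi) hxg
  exact Set.mem_biUnion hF hx

lemma norm_le_one_of_mem_hull {x : E3} (hx : x ∈ convexHull ℝ (P.V : Set E3)) : ‖x‖ ≤ 1 := by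
  have := convexHull_min (t := Metric.closedBall (0 : E3) 1)
    (fun v hv => by simp [P.on_sphere v hv]) (convex_closedBall _ _) hx
  simpa using this

lemma smul_notMem_trunc (h0 : (0 : E3) ∈ interior (convexHull ℝ (P.V : Set E3)))
    {v : E3} (hv : v ∈ P.V) {F : Set E3} (hF : F ∈ P.faces) (hvF : v ∉ F) {s : ℝ} (hs : 0 < s) :
    s • v ∉ trunc F := by
  rintro ⟨⟨t, y⟩, ⟨⟨ht0, -⟩, hy⟩, hty⟩
  obtain ⟨a, b, c, u, r, ha, hb, hc, -, rfl, hu, hle, heq⟩ := P.exists_supporting_of_mem_faces hF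
  have hv1 := P.on_sphere v hv
  have hr : 0 < r := by
    have hcont : Continuous fun ε : ℝ => ε • u := by fun_prop
    have hnhds : ∀ᶠ ε in nhds (0 : ℝ), ε • u ∈ interior (convexHull ℝ (P.V : Set E3)) :=
      hcont.continuousAt.eventually (isOpen_interior.mem_nhds (by simpa using h0))
    obtain ⟨ε, hε, hε0⟩ := (hnhds.filter_mono nhdsWithin_le_nhds |>.and
      (self_mem_nhdsWithin (s := Set.Ioi (0 : ℝ)))).exists
    have h1 := inner_le_of_mem_convexHull (V := (P.V : Set E3)) hle (interior_subset hε)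
    rw [inner_smul_right] at h1
    exact (mul_pos hε0 (real_inner_self_pos.2 hu)).trans_le h1
  have hsub : ({a, b, c} : Set E3) ⊆ P.V := by
    rintro x (rfl | rfl | rfl) <;> assumption
  have hplane : ({a, b, c} : Set E3) ⊆ {w ∈ (P.V : Set E3) | inner ℝ u w = r} :=
    fun w hw => ⟨hsub hw, (heq w (hsub hw)).2 hw⟩
  have hyr : inner ℝ u y = r := inner_eq_of_mem_convexHull (convexHull_mono hplane hy)
  have ht : 0 < t := by
    refine lt_of_le_of_ne ht0 ?_
    rintro rfl
    have : s • v = 0 := by simpa using hty.symm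
    rw [smul_eq_zero] at this
    rcases this with h | h
    · exact hs.ne' h
    · rw [h] at hv1
      simp at hv1
  have hyv : y = (s / t) • v := by
    rw [div_eq_inv_mul, mul_smul, ← hty]
    simp [smul_smul, ht.ne']
  have hl0 : 0 < s / t := by positivity
  have hl1 : s / t ≤ 1 := by
    have := P.norm_le_one_of_mem_hull (convexHull_mono hsub hy)
    rwa [hyv, norm_smul, hv1, mul_one, Real.norm_of_nonneg hl0.le] at this
  have hl2 : 1 ≤ s / t := by
    rw [hyv, inner_smul_right] at hyr
    have := hle v hv
    by_contra hcon
    nlinarith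
  rw [le_antisymm hl1 hl2, one_smul] at hyv
  exact hvF (hyv ▸ hy)

lemma exists_triple_of_mem_face {v : E3} (hv : v ∈ P.V) {F : Set E3} (hF : F ∈ P.faces)
    (hvF : v ∈ F) : ∃ p q : E3, p ∈ P.V ∧ q ∈ P.V ∧ AffineIndependent ℝ ![v, p, q] ∧
      F = convexHull ℝ {v, p, q} := by
  obtain ⟨a, b, c, -, -, ha, hb, hc, habc, rfl, -⟩ := P.exists_supporting_of_mem_faces hF
  have hsub : ({a, b, c} : Set E3) ⊆ P.V := by
    rintro x (rfl | rfl | rfl) <;> assumption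
  rcases P.mem_of_mem_convexHull hsub hv hvF with rfl | rfl | rfl
  · exact ⟨b, c, hb, hc, habc, rfl⟩
  · exact ⟨c, a, hc, ha, affineIndependent_rotate habc, by rw [triple_rotate a v c]⟩
  · exact ⟨a, b, ha, hb, affineIndependent_rotate (affineIndependent_rotate habc),
      by rw [triple_rotate b v a, triple_rotate a b v]⟩

lemma exists_wide_face (h0 : (0 : E3) ∈ interior (convexHull ℝ (P.V : Set E3))) :
    ∃ v p q : E3, v ∈ P.V ∧ p ∈ P.V ∧ q ∈ P.V ∧ AffineIndependent ℝ ![v, p, q] ∧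
      convexHull ℝ {v, p, q} ∈ P.faces ∧
      inner ℝ p q - inner ℝ v p * inner ℝ v q ≤
        Real.cos (2 * π / 5) * (√(1 - inner ℝ v p ^ 2) * √(1 - inner ℝ v q ^ 2)) := by
  classical
  obtain ⟨v, hv, hcard⟩ := P.exists_low_degree
  have hv1 := P.on_sphere v hv
  have hvv : inner ℝ v v = (1 : ℝ) := by rw [real_inner_self_eq_norm_sq, hv1, one_pow]
  choose! p q hp hq hvpq hF using fun F (hF : F ∈ P.faces.filter (v ∈ ·)) =>
    P.exists_triple_of_mem_face hv (Finset.mem_filter.1 hF).1 (Finset.mem_filter.1 hF).2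
  obtain ⟨F, hFs, hwide⟩ := exists_wide_sector hcard hv1
    (fun F => p F - (inner ℝ v (p F) : ℝ) • v) (fun F => q F - (inner ℝ v (q F) : ℝ) • v)
    (fun F _ => by rw [inner_sub_right, inner_smul_right, hvv]; ring)
    (fun F _ => by rw [inner_sub_right, inner_smul_right, hvv]; ring) (by
      intro φ hφ hvφ
      have hmem : ((1 / 2 : ℝ) • v) ∈ interior (convexHull ℝ (P.V : Set E3)) ∩
          ⋂ F ∈ P.faces.filter (v ∉ ·), (trunc F)ᶜ := by
        refine ⟨?_, ?_⟩
        · have := (convex_convexHull ℝ (P.V : Set E3)).combo_interior_self_mem_interior h0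
            (subset_convexHull ℝ _ hv) (a := 1 / 2) (b := 1 / 2) (by norm_num) (by norm_num)
            (by norm_num)
          simpa using this
        · simp only [Set.mem_iInter]
          intro F hF
          rw [Finset.mem_filter] at hF
          exact P.smul_notMem_trunc h0 hv hF.1 hF.2 (by norm_num)
      have hopen : IsOpen (interior (convexHull ℝ (P.V : Set E3)) ∩
          ⋂ F ∈ P.faces.filter (v ∉ ·), (trunc F)ᶜ) :=
        isOpen_interior.inter (isOpen_biInter_finset fun F hF =>
          (P.isClosed_trunc (Finset.mem_filter.1 hF).1).isOpen_compl)
      have hcont : Continuous fun δ : ℝ => (1 / 2 : ℝ) • v + δ • φ := by fun_prop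
      have hnhds := (hcont.continuousAt (x := 0)).eventually (hopen.mem_nhds (by simpa using hmem))
      obtain ⟨δ, ⟨hδi, hδF⟩, hδ0⟩ := (hnhds.filter_mono nhdsWithin_le_nhds |>.and
        (self_mem_nhdsWithin (s := Set.Ioi (0 : ℝ)))).exists
      replace hδ0 : 0 < δ := hδ0
      obtain ⟨F, hFf, hδt⟩ := Set.mem_iUnion₂.1 (P.interior_subset_iUnion_trunc h0 hδi)
      have hvF : v ∈ F := by
        by_contra hvF
        exact Set.mem_iInter₂.1 hδF F (Finset.mem_filter.2 ⟨hFf, hvF⟩) hδt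
      have hFs : F ∈ P.faces.filter (v ∈ ·) := Finset.mem_filter.2 ⟨hFf, hvF⟩
      refine ⟨F, hFs, ?_⟩
      obtain ⟨⟨t, y⟩, ⟨⟨ht0, -⟩, hy⟩, hty⟩ := hδt
      rw [hF F hFs] at hy
      obtain ⟨α, β, γ, -, hβ, hγ, -, rfl⟩ := mem_convexHull_triple.1 hy
      simp only at hty
      refine ⟨t * β / δ, t * γ / δ, by positivity, by positivity, ?_⟩
      have h1 := congrArg (inner ℝ v) hty
      simp only [inner_add_right, inner_smul_right, hvv, hvφ] at h1
      have h2 : δ • φ = (t * β) • (p F - (inner ℝ v (p F) : ℝ) • v) +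
          (t * γ) • (q F - (inner ℝ v (q F) : ℝ) • v) := by
        have h3 : δ • φ = t • (α • v + β • p F + γ • q F) - (1 / 2 : ℝ) • v := by
          rw [hty]; abel
        rw [h3, show (1 / 2 : ℝ) = t * (α * 1 + β * inner ℝ v (p F) + γ * inner ℝ v (q F)) by
          linarith]
        module
      have h3 : φ = δ⁻¹ • (δ • φ) := by simp [smul_smul, hδ0.ne']
      rw [h3, h2]
      module)
  have hFf := (Finset.mem_filter.1 hFs).1
  refine ⟨v, p F, q F, hv, hp F hFs, hq F hFs, hvpq F hFs, hF F hFs ▸ hFf, ?_⟩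
  have hnorm : ∀ w : E3, ‖w‖ = 1 →
      ‖w - (inner ℝ v w : ℝ) • v‖ = √(1 - inner ℝ v w ^ 2) := by
    intro w hw
    rw [← Real.sqrt_sq (norm_nonneg (w - (inner ℝ v w : ℝ) • v)), norm_sub_sq_real,
      inner_smul_right, norm_smul, hv1, hw, real_inner_comm, Real.norm_eq_abs, mul_one, sq_abs]
    congr 1
    ring
  rw [hnorm _ (P.on_sphere _ (hp F hFs)), hnorm _ (P.on_sphere _ (hq F hFs))] at hwide
  refine le_trans (le_of_eq ?_) hwide
  simp only [inner_sub_left, inner_sub_right, inner_smul_left, inner_smul_right, hvv,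
    real_inner_comm v (p F), conj_trivial]
  ring

end InscribedTriPoly

lemma four_mul_sin_sq_pi_div_five : 4 * Real.sin (π / 5) ^ 2 = 2 * (1 - Real.cos (2 * π / 5)) := by
  rw [show 2 * π / 5 = 2 * (π / 5) by ring, Real.cos_two_mul, Real.sin_sq]
  ring

lemma cos_two_pi_div_five_mem : Real.cos (2 * π / 5) ∈ Set.Icc (1 / 4) 1 := by
  refine ⟨?_, Real.cos_le_one _⟩
  have h5 : (2 : ℝ) ≤ √5 := Real.le_sqrt_of_sq_le (by norm_num)
  have hs : √5 ^ 2 = 5 := Real.sq_sqrt (by norm_num)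
  rw [show 2 * π / 5 = 2 * (π / 5) by ring, Real.cos_two_mul, Real.cos_pi_div_five]
  nlinarith

lemma le_or_le_or_le_of_sub_mul_le {k C x y z : ℝ} (hk0 : 0 < k) (hk1 : k ≤ 1)
    (hx1 : x ^ 2 ≤ 1) (hy1 : y ^ 2 ≤ 1) (hx : x ≤ C) (hy : y ≤ C)
    (h : z - x * y ≤ k * (√(1 - x ^ 2) * √(1 - y ^ 2))) :
    x ≤ C ^ 2 + k * (1 - C ^ 2) ∨ y ≤ C ^ 2 + k * (1 - C ^ 2) ∨ z ≤ C ^ 2 + k * (1 - C ^ 2) := by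
  by_contra! hcon
  obtain ⟨h1, h2, h3⟩ := hcon
  have hB : 0 < C ^ 2 + k * (1 - C ^ 2) := by nlinarith [sq_nonneg C]
  have hs1 : √(1 - x ^ 2) ^ 2 = 1 - x ^ 2 := Real.sq_sqrt (by linarith)
  have hs2 : √(1 - y ^ 2) ^ 2 = 1 - y ^ 2 := Real.sq_sqrt (by linarith)
  have hs : √(1 - x ^ 2) * √(1 - y ^ 2) ≤ 1 - (x ^ 2 + y ^ 2) / 2 := by
    nlinarith [sq_nonneg (√(1 - x ^ 2) - √(1 - y ^ 2))]
  have hks := mul_le_mul_of_nonneg_left hs hk0.le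
  have hst : 0 ≤ (1 - k) * (C * (C - y) + (C - x) * y) :=
    mul_nonneg (by linarith) (add_nonneg (mul_nonneg (by linarith) (by linarith))
      (mul_nonneg (by linarith) (by linarith)))
  nlinarith [mul_nonneg hk0.le (sq_nonneg (x - y))]

lemma two_mul_sin_mul_le_of_sq_le {a b : ℝ} (ha : 0 ≤ a) (ha2 : a ≤ 2) (hb : 0 ≤ b)
    (h : 2 * (1 - Real.cos (2 * π / 5)) * (a ^ 2 * (1 - a ^ 2 / 4)) ≤ b ^ 2) :
    2 * Real.sin (π / 5) * √(1 - a ^ 2 / 4) * a ≤ b := by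
  refine le_of_sq_le_sq ?_ hb
  rw [mul_pow, mul_pow, mul_pow, Real.sq_sqrt (by nlinarith)]
  rw [← four_mul_sin_sq_pi_div_five] at h
  linarith

namespace InscribedTriPoly

variable {m : ℕ} (P : InscribedTriPoly m)

lemma exists_long_edge_of_zero_mem_interior
    (h0 : (0 : E3) ∈ interior (convexHull ℝ (P.V : Set E3))) {a : ℝ} (ha : 0 ≤ a) (ha2 : a ≤ 2)
    (hmin : ∀ v ∈ P.V, ∀ w ∈ P.V, v ≠ w → a ≤ dist v w) :
    ∃ b ∈ edgeLengths P.V, 2 * Real.sin (π / 5) * √(1 - a ^ 2 / 4) * a ≤ b := by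
  obtain ⟨v, p, q, hv, hp, hq, hind, hF, hwide⟩ := P.exists_wide_face h0
  have hinj := hind.injective
  have hvp : v ≠ p := by simpa using hinj.ne (show (0 : Fin 3) ≠ 1 by decide)
  have hvq : v ≠ q := by simpa using hinj.ne (show (0 : Fin 3) ≠ 2 by decide)
  obtain ⟨e1, e2, e3⟩ := mem_edgeLengths_of_triangle hind (P.mem_faces.1 hF).2.2.1
  have hle : ∀ x ∈ P.V, ∀ y ∈ P.V, x ≠ y → inner ℝ x y ≤ 1 - a ^ 2 / 2 := by
    intro x hx y hy hxy
    rw [real_inner_eq_of_norm_one (P.on_sphere x hx) (P.on_sphere y hy)]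
    have := pow_le_pow_left₀ ha (hmin x hx y hy hxy) 2
    linarith
  have hsq : ∀ x ∈ P.V, ∀ y ∈ P.V, inner ℝ x y ^ 2 ≤ (1 : ℝ) := by
    intro x hx y hy
    have := abs_real_inner_le_norm x y
    rw [P.on_sphere x hx, P.on_sphere y hy, mul_one] at this
    exact (sq_le_one_iff_abs_le_one _).2 this
  have hlong : ∀ x ∈ P.V, ∀ y ∈ P.V, inner ℝ x y ≤ (1 - a ^ 2 / 2) ^ 2 +
      Real.cos (2 * π / 5) * (1 - (1 - a ^ 2 / 2) ^ 2) →
      2 * Real.sin (π / 5) * √(1 - a ^ 2 / 4) * a ≤ dist x y := by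
    intro x hx y hy h
    refine two_mul_sin_mul_le_of_sq_le ha ha2 dist_nonneg ?_
    rw [real_inner_eq_of_norm_one (P.on_sphere x hx) (P.on_sphere y hy)] at h
    linarith
  obtain ⟨hk0, hk1⟩ := cos_two_pi_div_five_mem
  rcases le_or_le_or_le_of_sub_mul_le (C := 1 - a ^ 2 / 2) (by linarith) hk1 (hsq v hv p hp)
    (hsq v hv q hq) (hle v hv p hp hvp) (hle v hv q hq hvq) hwide with h | h | h
  · exact ⟨_, e1, hlong v hv p hp h⟩
  · exact ⟨_, e3, by rw [dist_comm]; exact hlong v hv q hq h⟩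
  · exact ⟨_, e2, hlong p hp q hq h⟩

lemma exists_supporting_foot (h0 : (0 : E3) ∉ interior (convexHull ℝ (P.V : Set E3))) :
    ∃ (n : E3) (h : ℝ), n ≠ 0 ∧ h • n ∈ convexHull ℝ (P.V : Set E3) ∧ 0 ≤ h ∧
      ∀ w ∈ P.V, inner ℝ n (h • n) ≤ inner ℝ n w := by
  by_cases hH : (0 : E3) ∈ convexHull ℝ (P.V : Set E3)
  · obtain ⟨f, hf⟩ := geometric_hahn_banach_open_point (convex_convexHull ℝ _).interior
      isOpen_interior h0
    have hne := interior_convexHull_nonempty_iff_affineSpan_eq_top.2 P.full_dim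
    set u := (InnerProductSpace.toDual ℝ E3).symm f with hu
    have huf : ∀ z, inner ℝ u z = f z := fun z => InnerProductSpace.toDual_symm_apply
    refine ⟨-u, 0, ?_, by simpa using hH, le_rfl, fun w hw => ?_⟩
    · intro h
      obtain ⟨z, hz⟩ := hne
      have h1 := hf z hz
      rw [← huf, ← huf, neg_eq_zero.1 h] at h1
      simp at h1
    · have hcl : w ∈ closure (interior (convexHull ℝ (P.V : Set E3))) := by
        rw [(convex_convexHull ℝ _).closure_interior_eq_closure_of_nonempty_interior hne]
        exact subset_closure (subset_convexHull ℝ _ hw)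
      have h1 : f w ≤ f 0 := closure_minimal (fun y hy => (hf y hy).le)
        (isClosed_le f.continuous continuous_const) hcl
      rw [map_zero] at h1
      rw [zero_smul, inner_zero_right, inner_neg_left, huf]
      linarith
  · obtain ⟨c, hc, hmin⟩ := exists_norm_eq_iInf_of_complete_convex
      (K := convexHull ℝ (P.V : Set E3))
      (P.nonempty_V.to_set.convexHull) P.isCompact_hull.isComplete (convex_convexHull ℝ _) 0
    rw [norm_eq_iInf_iff_real_inner_le_zero (convex_convexHull ℝ _) hc] at hmin
    refine ⟨c, 1, fun h => hH (h ▸ hc), by simpa using hc, zero_le_one, fun w hw => ?_⟩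
    have := hmin w (subset_convexHull ℝ _ hw)
    rw [zero_sub, inner_neg_left, inner_sub_right] at this
    rw [one_smul]
    linarith

lemma exists_inner_ne {u : E3} (hu : u ≠ 0) (r : ℝ) : ∃ w ∈ P.V, inner ℝ u w ≠ r := by
  by_contra! hcon
  have h := finrank_vectorSpan_le_two (S := (P.V : Set E3)) hu hcon
  rw [← direction_affineSpan, P.full_dim, AffineSubspace.direction_top, finrank_top,
    finrank_euclideanSpace, Fintype.card_fin] at h
  lia

lemma mem_edgeLengths_of_eq_pair {u : E3} {r : ℝ} (h : ∀ w ∈ P.V, inner ℝ u w ≤ r) {p q : E3}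
    (hpq : p ≠ q) (hG : {w ∈ (P.V : Set E3) | inner ℝ u w = r} = {p, q}) :
    dist p q ∈ edgeLengths P.V := by
  refine ⟨p, q, hpq, isFaceDim_segment hpq ?_, rfl⟩
  rw [← convexHull_pair, ← hG]
  exact isExtreme_convexHull_sep h

lemma mem_faces_of_three {u : E3} {r : ℝ} (hu : u ≠ 0) (h : ∀ w ∈ P.V, inner ℝ u w ≤ r)
    {x y z : E3} (hxy : x ≠ y) (hxz : x ≠ z) (hyz : y ≠ z)
    (hG : {x, y, z} ⊆ {w ∈ (P.V : Set E3) | inner ℝ u w = r}) :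
    convexHull ℝ {w ∈ (P.V : Set E3) | inner ℝ u w = r} ∈ P.faces := by
  rw [mem_faces]
  refine isFaceDim_convexHull_sep h ⟨x, hG (by simp)⟩
    (le_antisymm (finrank_vectorSpan_le_two hu (r := r) fun w hw => hw.2) ?_)
  have hcos : EuclideanGeometry.Cospherical ({x, y, z} : Set E3) :=
    ⟨0, 1, fun w hw => by rw [dist_zero_right]; exact P.on_sphere w (hG hw).1⟩
  have hind := hcos.affineIndependent_of_ne hxy hxz hyz
  rw [← hind.finrank_vectorSpan (n := 2) (by simp)]
  refine Submodule.finrank_mono (vectorSpan_mono ℝ ?_)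
  rintro _ ⟨i, rfl⟩
  fin_cases i
  exacts [hG (by simp), hG (by simp), hG (by simp)]

lemma exists_long_edge_of_zero_notMem_interior
    (h0 : (0 : E3) ∉ interior (convexHull ℝ (P.V : Set E3))) {a : ℝ} (ha : 0 < a)
    (hmin : ∀ v ∈ P.V, ∀ w ∈ P.V, v ≠ w → a ≤ dist v w) :
    ∃ b ∈ edgeLengths P.V, 0 ≤ b ∧ 3 / 2 * a ^ 2 ≤ b ^ 2 := by
  obtain ⟨n, h, hn, hc, hh, hle⟩ := P.exists_supporting_foot h0
  set c := h • n with hcdef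
  set r := inner ℝ (-n) c with hr
  have hleV : ∀ w ∈ P.V, inner ℝ (-n) w ≤ r := by
    intro w hw
    rw [hr, inner_neg_left, inner_neg_left]
    linarith [hle w hw]
  have hcG : c ∈ convexHull ℝ {w ∈ (P.V : Set E3) | inner ℝ (-n) w = r} := by
    rcases mem_convexHull_or_inner_lt (V := (P.V : Set E3)) hleV hc with h | h
    · exact h.2
    · exact absurd rfl h.ne
  set G := {w ∈ (P.V : Set E3) | inner ℝ (-n) w = r} with hG
  set ρ : ℝ := inner ℝ c c with hρ
  have hGc : ∀ w ∈ G, inner ℝ w c = ρ := by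
    rintro w ⟨-, hw⟩
    rw [hr, inner_neg_left, inner_neg_left, neg_inj] at hw
    rw [hρ, real_inner_comm, hcdef, inner_smul_left, inner_smul_left, hw]
  obtain ⟨w, hw, hwr⟩ := P.exists_inner_ne (neg_ne_zero.2 hn) r
  have hwc : ρ ≤ inner ℝ w c := by
    have hcx : ∀ x, inner ℝ c x = h * inner ℝ n x := fun x => real_inner_smul_left _ _ _
    rw [hρ, real_inner_comm c w, hcx, hcx]
    exact mul_le_mul_of_nonneg_left (hle w hw) hh
  obtain ⟨p, hp, hwp⟩ : ∃ p ∈ G, ρ ≤ inner ℝ w p := by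
    by_contra! hcon
    have := convexHull_min (t := {x | inner ℝ w x < ρ}) hcon
      (convex_halfSpace_lt (innerₛₗ ℝ w).isLinear ρ) hcG
    exact absurd this (not_lt.2 hwc)
  have haρ : a ^ 2 ≤ 2 * (1 - ρ) := by
    have h1 := pow_le_pow_left₀ ha.le (hmin w hw p hp.1 (by rintro rfl; exact hwr hp.2)) 2
    rw [real_inner_eq_of_norm_one (P.on_sphere w hw) (P.on_sphere p hp.1)] at hwp
    linarith
  have hρ1 : ρ < 1 := by nlinarith [pow_pos ha 2]
  have hlong : ∀ x ∈ G, ∀ y ∈ G, inner ℝ x y ≤ (3 * ρ - 1) / 2 →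
      3 / 2 * a ^ 2 ≤ dist x y ^ 2 := by
    intro x hx y hy hxy
    rw [real_inner_eq_of_norm_one (P.on_sphere x hx.1) (P.on_sphere y hy.1)] at hxy
    linarith
  have hself : ∀ x ∈ G, inner ℝ x x = (1 : ℝ) := fun x hx => by
    rw [real_inner_self_eq_norm_sq, P.on_sphere x hx.1, one_pow]
  by_cases hthree : ∃ x y z : E3, x ≠ y ∧ x ≠ z ∧ y ≠ z ∧ {x, y, z} ⊆ G
  · obtain ⟨x, y, z, hxy, hxz, hyz, hsub⟩ := hthree
    have hF := P.mem_faces_of_three (neg_ne_zero.2 hn) hleV hxy hxz hyz hsub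
    obtain ⟨x, y, z, -, -, hx, hy, hz, hind, hFe, -⟩ := P.exists_supporting_of_mem_faces hF
    have hmemG : ∀ w ∈ P.V, w ∈ ({x, y, z} : Set E3) → w ∈ G := by
      intro w hw hwt
      refine P.mem_of_mem_convexHull (Set.sep_subset _ _) hw ?_
      rw [hFe]
      exact subset_convexHull ℝ _ hwt
    replace hx := hmemG x hx (by simp)
    replace hy := hmemG y hy (by simp)
    replace hz := hmemG z hz (by simp)
    obtain ⟨e1, e2, e3⟩ := mem_edgeLengths_of_triangle hind
      (by rw [← hFe]; exact (P.mem_faces.1 hF).2.2.1)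
    rw [hFe] at hcG
    obtain ⟨α, β, γ, hα, hβ, hγ, hsum, hcomb⟩ := mem_convexHull_triple.1 hcG
    have key : ∀ {x y z : E3} {α β γ : ℝ}, x ∈ G → 0 ≤ β → 0 ≤ γ → α + β + γ = 1 →
        1 / 3 ≤ α → α • x + β • y + γ • z = c →
        inner ℝ x y ≤ (3 * ρ - 1) / 2 ∨ inner ℝ x z ≤ (3 * ρ - 1) / 2 := by
      intro x y z α β γ hx hβ hγ hsum hα hcomb
      by_contra! hcon
      have h1 := hGc x hx
      rw [← hcomb, inner_add_right, inner_add_right, inner_smul_right, inner_smul_right,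
        inner_smul_right, hself x hx] at h1
      have h2 := mul_le_mul_of_nonneg_left hcon.1.le hβ
      have h3 := mul_le_mul_of_nonneg_left hcon.2.le hγ
      rcases hβ.eq_or_lt with rfl | hβ0
      · rcases hγ.eq_or_lt with rfl | hγ0
        · nlinarith
        · have h4 := mul_lt_mul_of_pos_left hcon.2 hγ0
          nlinarith
      · have h4 := mul_lt_mul_of_pos_left hcon.1 hβ0
        nlinarith
    have hbig : 1 / 3 ≤ α ∨ 1 / 3 ≤ β ∨ 1 / 3 ≤ γ := by
      by_contra! hcon
      linarith [hcon.1, hcon.2.1, hcon.2.2]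
    rcases hbig with hb | hb | hb
    · rcases key hx hβ hγ hsum hb hcomb with h | h
      · exact ⟨_, e1, dist_nonneg, hlong x hx y hy h⟩
      · exact ⟨_, e3, dist_nonneg, by rw [dist_comm]; exact hlong x hx z hz h⟩
    · rcases key (y := z) (z := x) (β := γ) (γ := α) hy hγ hα (by linarith) hb
        (by rw [← hcomb]; abel) with h | h
      · exact ⟨_, e2, dist_nonneg, hlong y hy z hz h⟩
      · exact ⟨_, e1, dist_nonneg, by rw [dist_comm]; exact hlong y hy x hx h⟩
    · rcases key (y := x) (z := y) (β := α) (γ := β) hz hα hβ (by linarith) hb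
        (by rw [← hcomb]; abel) with h | h
      · exact ⟨_, e3, dist_nonneg, hlong z hz x hx h⟩
      · exact ⟨_, e2, dist_nonneg, by rw [dist_comm]; exact hlong z hz y hy h⟩
  · push Not at hthree
    have hex : ∃ q ∈ G, p ≠ q := by
      by_contra! hcon
      have hGp : G = {p} := Set.eq_singleton_iff_unique_mem.2 ⟨hp, fun q hq => (hcon q hq).symm⟩
      rw [hGp, convexHull_singleton, Set.mem_singleton_iff] at hcG
      have := hself p hp
      rw [← hcG] at this
      exact hρ1.ne this
    obtain ⟨q, hq, hpq⟩ := hex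
    have hGpq : G = {p, q} := by
      refine Set.Subset.antisymm (fun x hx => ?_) ?_
      · by_contra hxn
        simp only [Set.mem_insert_iff, Set.mem_singleton_iff, not_or] at hxn
        refine hthree p q x hpq (Ne.symm hxn.1) (Ne.symm hxn.2) ?_
        rintro y (rfl | rfl | rfl) <;> assumption
      · rintro y (rfl | rfl) <;> assumption
    refine ⟨_, P.mem_edgeLengths_of_eq_pair hleV hpq hGpq, dist_nonneg, hlong p hp q hq ?_⟩
    rw [hGpq, convexHull_pair] at hcG
    obtain ⟨α, β, hα, hβ, hsum, hcomb⟩ := hcG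
    have h1 := hGc p hp
    have h2 := hGc q hq
    rw [← hcomb, inner_add_right, inner_smul_right, inner_smul_right] at h1 h2
    rw [hself p hp] at h1
    rw [hself q hq, real_inner_comm] at h2
    have h3 : (α + β) * (1 + inner ℝ p q) = 2 * ρ := by linarith
    rw [hsum] at h3
    linarith

end InscribedTriPoly

lemma le_dSphere {V : Finset E3} (hV : ∀ v ∈ V, ‖v‖ = 1) {k : ℕ} (hk : 2 ≤ k) (hkV : k ≤ V.card)
    {a : ℝ} (hmin : ∀ v ∈ V, ∀ w ∈ V, v ≠ w → a ≤ dist v w) : a ≤ dSphere k := by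
  obtain ⟨T, hTV, hT⟩ := Finset.exists_subset_card_eq hkV
  let f := T.equivFinOfCardEq hT
  have h01 : (⟨0, by lia⟩ : Fin k) ≠ ⟨1, by lia⟩ := by simp
  have hmem : ∀ i, (f.symm i : E3) ∈ V := fun i => hTV (f.symm i).2
  refine le_csSup_of_le ⟨2, ?_⟩ ⟨fun i => f.symm i, fun i => hV _ (hmem i), rfl⟩ ?_
  · rintro _ ⟨P, hP, rfl⟩
    refine le_trans (csInf_le ⟨0, ?_⟩ ⟨_, _, h01, rfl⟩) ?_
    · rintro d ⟨i, j, -, rfl⟩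
      exact dist_nonneg
    · refine (dist_le_norm_add_norm _ _).trans ?_
      rw [hP, hP]
      norm_num
  · refine le_csInf ⟨_, _, _, h01, rfl⟩ ?_
    rintro d ⟨i, j, hij, rfl⟩
    exact hmin _ (hmem i) _ (hmem j) fun h => hij (f.symm.injective (Subtype.ext h))

namespace InscribedTriPoly

variable {m : ℕ} (P : InscribedTriPoly m)

lemma exists_long_edge {a : ℝ} (ha : 0 < a) (ha2 : a ≤ 2)
    (hmin : ∀ v ∈ P.V, ∀ w ∈ P.V, v ≠ w → a ≤ dist v w) :
    ∃ b ∈ edgeLengths P.V, 2 * Real.sin (π / 5) * √(1 - a ^ 2 / 4) * a ≤ b := by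
  by_cases h0 : (0 : E3) ∈ interior (convexHull ℝ (P.V : Set E3))
  · exact P.exists_long_edge_of_zero_mem_interior h0 ha.le ha2 hmin
  · obtain ⟨b, hb, hb0, hab⟩ := P.exists_long_edge_of_zero_notMem_interior h0 ha hmin
    refine ⟨b, hb, two_mul_sin_mul_le_of_sq_le ha.le ha2 hb0 (le_trans ?_ hab)⟩
    obtain ⟨hk0, hk1⟩ := cos_two_pi_div_five_mem
    refine mul_le_mul (by linarith) ?_ ?_ (by norm_num)
    · nlinarith [sq_nonneg (a ^ 2)]
    · exact mul_nonneg (sq_nonneg a) (by nlinarith)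

lemma exists_closest : ∃ p ∈ P.V, ∃ q ∈ P.V, p ≠ q ∧
    ∀ v ∈ P.V, ∀ w ∈ P.V, v ≠ w → dist p q ≤ dist v w := by
  classical
  obtain ⟨v, hv, w, hw, hvw⟩ := P.exists_ne
  obtain ⟨⟨p, q⟩, hpq, hmin⟩ := P.V.offDiag.exists_min_image (fun x => dist x.1 x.2)
    ⟨(v, w), Finset.mem_offDiag.2 ⟨hv, hw, hvw⟩⟩
  rw [Finset.mem_offDiag] at hpq
  exact ⟨p, hpq.1, q, hpq.2.1, hpq.2.2, fun v hv w hw hvw =>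
    hmin (v, w) (Finset.mem_offDiag.2 ⟨hv, hw, hvw⟩)⟩

lemma dSphere_le_eta {k : ℕ} (hk : m + 4 = 2 * k) :
    2 * Real.sin (π / 5) * √(1 - dSphere k ^ 2 / 4) ≤ eta P.V := by
  obtain ⟨p, hp, q, hq, hpq, hmin⟩ := P.exists_closest
  have ha : 0 < dist p q := dist_pos.2 hpq
  have ha2 : dist p q ≤ 2 := by
    refine (dist_le_norm_add_norm _ _).trans ?_
    rw [P.on_sphere p hp, P.on_sphere q hq]
    norm_num
  have hd : dist p q ≤ dSphere k :=
    le_dSphere P.on_sphere (by lia) (by have := P.card_faces_add_four_le; lia) hmin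
  obtain ⟨b, hb, hab⟩ := P.exists_long_edge ha ha2 hmin
  have hsin : 0 ≤ Real.sin (π / 5) :=
    Real.sin_nonneg_of_nonneg_of_le_pi (by positivity) (by linarith [Real.pi_pos])
  calc 2 * Real.sin (π / 5) * √(1 - dSphere k ^ 2 / 4)
      ≤ 2 * Real.sin (π / 5) * √(1 - dist p q ^ 2 / 4) := by gcongr
    _ ≤ b / dist p q := (le_div_iff₀ ha).2 hab
    _ ≤ eta P.V := div_le_eta P.on_sphere hp hq hpq hmin hb

end InscribedTriPoly

/-- For a convex polyhedron inscribed in the unit sphere with `m` faces, all triangles,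
and `k = m/2 + 2` (the number of vertices),
`η ≥ 2 sin 36° √(1 − d_k²/4) ≥ sin 36° / sin(30°(m+4)/m)`. -/
theorem eta_lower_bound (m k : ℕ) (hk : m + 4 = 2 * k) (P : InscribedTriPoly m) :
    2 * Real.sin (π / 5) * Real.sqrt (1 - dSphere k ^ 2 / 4) ≤ eta P.V ∧
    Real.sin (π / 5) / Real.sin (π / 6 * ((m : ℝ) + 4) / m) ≤
      2 * Real.sin (π / 5) * Real.sqrt (1 - dSphere k ^ 2 / 4) := by
  exact ⟨P.dSphere_le_eta hk, sin_div_sin_le_dSphere hk⟩
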